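/- arXiv:1512.04421 — 5 statements merged into one kernel-verified Lean document; each statement's English description precedes it below -/
import Mathlib

section
/- Let 0 < p ≤ 1 and 0 < q ≤ 1, let X be a real vector space equipped with a p-norm ‖·‖_X and Y a real vector space equipped with a q-norm ‖·‖_Y, and let α > 0. Then for every bounded linear operator T : X → Y and every n ∈ ℕ, sup_{1 ≤ k ≤ n} k^α e_k(T) ≤ 2^{2α + 3/q + 2/p} · (2/p + α + 1/q + 2)^α · sup_{1 ≤ k ≤ n} k^α c_k(T). -/
/-- A `p`-norm on a real vector space `X` (for `0 < p ≤ 1`): positive definite,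
absolutely homogeneous, and satisfying the `p`-triangle inequality. -/
structure IsPNorm {X : Type*} [AddCommGroup X] [Module ℝ X] (p : ℝ) (N : X → ℝ) : Prop where
  nonneg : ∀ x, 0 ≤ N x
  eq_zero_iff : ∀ x, N x = 0 ↔ x = 0
  smul_eq : ∀ (a : ℝ) (x : X), N (a • x) = |a| * N x
  padd : ∀ x y, N (x + y) ^ p ≤ N x ^ p + N y ^ p

/-- The `k`-th entropy number of a linear operator `T : X → Y` between quasi-normed
spaces: the infimum of all `ε > 0` such that `T(B_X)` can be covered by `2^(k-1)`
open `ε`-balls in `Y`. -/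
noncomputable def entropyNumber {X Y : Type*} [AddCommGroup X] [Module ℝ X]
    [AddCommGroup Y] [Module ℝ Y] (NX : X → ℝ) (NY : Y → ℝ)
    (T : X →ₗ[ℝ] Y) (k : ℕ) : ℝ :=
  sInf {ε : ℝ | 0 < ε ∧ ∃ c : Fin (2 ^ (k - 1)) → Y,
    ∀ x : X, NX x < 1 → ∃ i, NY (T x - c i) < ε}

/-- The `k`-th Gelfand number of a linear operator `T : X → Y`: the infimum over
subspaces `M ⊆ X` of codimension `< k` of `sup {‖Tx‖_Y : x ∈ M, ‖x‖_X ≤ 1}`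
(encoded as the infimum of all upper bounds `r` valid for some such `M`). -/
noncomputable def gelfandNumber {X Y : Type*} [AddCommGroup X] [Module ℝ X]
    [AddCommGroup Y] [Module ℝ Y] (NX : X → ℝ) (NY : Y → ℝ)
    (T : X →ₗ[ℝ] Y) (k : ℕ) : ℝ :=
  sInf {r : ℝ | ∃ M : Submodule ℝ X, Module.rank ℝ (X ⧸ M) < (k : Cardinal) ∧
    ∀ x ∈ M, NX x ≤ 1 → NY (T x) ≤ r}

open MeasureTheory Pointwise in
/-- Volume bound for separated sets in a finite-dimensional quotient. -/
lemma carl_sep_bound {X : Type*} [AddCommGroup X] [Module ℝ X] {p : ℝ} (hp0 : 0 < p) (hp1 : p ≤ 1)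
    {NX : X → ℝ} (hNX : IsPNorm p NX) {m : ℕ} (π : X →ₗ[ℝ] (Fin m → ℝ))
    (hπ : Function.Surjective π) {δ : ℝ} (hδ0 : 0 < δ) (hδ1 : δ ≤ 1) (S : Finset X)
    (hS : ∀ x ∈ S, NX x < 1)
    (hsep : ∀ x ∈ S, ∀ y ∈ S, x ≠ y → ∀ z, NX z < δ → π z ≠ π x - π y) :
    (S.card : ℝ) ≤ ((2 : ℝ) ^ (2 / p) / δ) ^ m := by
  obtain ⟨L, hL⟩ := LinearMap.exists_rightInverse_of_surjective π (LinearMap.range_eq_top.2 hπ)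
  have hL' : ∀ w, π (L w) = w := fun w => LinearMap.congr_fun hL w
  have hN0 : NX 0 = 0 := (hNX.eq_zero_iff 0).2 rfl
  have hneg : ∀ x, NX (-x) = NX x := fun x => by
    have := hNX.smul_eq (-1) x
    simpa using this
  -- bound for the lift
  have hC : ∃ C : ℝ, ∀ w, NX (L w) ^ p ≤ C * ‖w‖ ^ p := by
    refine ⟨∑ i, NX (L (Pi.single i 1)) ^ p, fun w => ?_⟩
    have h1 : L w = ∑ i, (w i) • L (Pi.single i 1) := by
      conv_lhs => rw [pi_eq_sum_univ' w]
      rw [map_sum]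
      refine Finset.sum_congr rfl fun i _ => ?_
      rw [map_smul]
    rw [h1]
    refine (Finset.le_sum_of_subadditive (fun x => NX x ^ p) ?_ hNX.padd _ _).trans ?_
    · simp only [hN0]
      exact (Real.zero_rpow hp0.ne').le
    · rw [Finset.sum_mul]
      refine Finset.sum_le_sum fun i _ => ?_
      rw [hNX.smul_eq, Real.mul_rpow (abs_nonneg _) (hNX.nonneg _), mul_comm]
      refine mul_le_mul_of_nonneg_left ?_ (Real.rpow_nonneg (hNX.nonneg _) _)
      exact Real.rpow_le_rpow (abs_nonneg _) (norm_le_pi_norm w i) hp0.le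
  obtain ⟨C, hC⟩ := hC
  -- radius
  obtain ⟨R, hR0, hR⟩ : ∃ R : ℝ, 0 < R ∧ ∀ x ∈ S, ‖π x‖ < R := by
    refine ⟨∑ x ∈ S, ‖π x‖ + 1, by positivity, fun x hx => ?_⟩
    have := Finset.single_le_sum (f := fun x => ‖π x‖) (fun i _ => norm_nonneg _) hx
    linarith
  set G : ℝ → Set (Fin m → ℝ) := fun t => {v | ‖v‖ < R * t ∧ ∃ x, NX x < t ∧ π x = v} with hG
  have hopen : ∀ t, 0 < t → IsOpen (G t) := by
    intro t ht
    rw [isOpen_iff_mem_nhds]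
    rintro v ⟨hv, x, hx, hxv⟩
    have e1 : ∀ᶠ w in nhds v, ‖w‖ < R * t :=
      (continuous_norm.tendsto v).eventually (gt_mem_nhds hv)
    have cont : Continuous fun w : Fin m → ℝ => NX x ^ p + C * ‖w - v‖ ^ p := by
      have : Continuous fun w : Fin m → ℝ => ‖w - v‖ ^ p :=
        (continuous_norm.comp (continuous_id.sub continuous_const)).rpow_const
          (fun _ => Or.inr hp0.le)
      fun_prop
    have e2 : ∀ᶠ w in nhds v, NX x ^ p + C * ‖w - v‖ ^ p < t ^ p := by
      refine (cont.tendsto v).eventually (gt_mem_nhds ?_)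
      simp only [sub_self, norm_zero, Real.zero_rpow hp0.ne', mul_zero, add_zero]
      exact Real.rpow_lt_rpow (hNX.nonneg _) hx hp0
    filter_upwards [e1, e2] with w h1 h2
    refine ⟨h1, x + L (w - v), ?_, ?_⟩
    · rw [← Real.rpow_lt_rpow_iff (hNX.nonneg _) ht.le hp0]
      have := hNX.padd x (L (w - v))
      have := hC (w - v)
      linarith
    · rw [map_add, hL', hxv]; abel
  have hadd : ∀ a b c, 0 < a → 0 < b → 0 < c → a ^ p + b ^ p ≤ c ^ p → ∀ v ∈ G a, ∀ w ∈ G b,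
      v + w ∈ G c := by
    rintro a b c ha hb hc habc v ⟨hv, x, hx, rfl⟩ w ⟨hw, y, hy, rfl⟩
    refine ⟨?_, x + y, ?_, map_add _ _ _⟩
    · have h1 : a + b ≤ c := by
        rw [← Real.rpow_le_rpow_iff (by positivity) hc.le hp0]
        exact (Real.rpow_add_le_add_rpow ha.le hb.le hp0.le hp1).trans habc
      have h2 := norm_add_le (π x) (π y)
      nlinarith
    · rw [← Real.rpow_lt_rpow_iff (hNX.nonneg _) hc.le hp0]
      have := hNX.padd x y
      have := Real.rpow_lt_rpow (hNX.nonneg _) hx hp0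
      have := Real.rpow_lt_rpow (hNX.nonneg _) hy hp0
      linarith
  have hGneg : ∀ t, ∀ v ∈ G t, -v ∈ G t := by
    rintro t v ⟨hv, x, hx, rfl⟩
    exact ⟨by rwa [norm_neg], -x, by rwa [hneg], map_neg _ _⟩
  have hsmul : ∀ t, 0 < t → G t = t • G 1 := by
    intro t ht
    ext v
    rw [Set.mem_smul_set_iff_inv_smul_mem₀ ht.ne']
    constructor
    · rintro ⟨hv, x, hx, rfl⟩
      refine ⟨?_, t⁻¹ • x, ?_, map_smul _ _ _⟩
      · rw [norm_smul, Real.norm_eq_abs, abs_of_pos (inv_pos.2 ht), inv_mul_lt_iff₀ ht]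
        linarith
      · rw [hNX.smul_eq, abs_of_pos (inv_pos.2 ht), inv_mul_lt_iff₀ ht]
        linarith
    · rintro ⟨hv, x, hx, hxv⟩
      refine ⟨?_, t • x, ?_, ?_⟩
      · rw [norm_smul, Real.norm_eq_abs, abs_of_pos (inv_pos.2 ht), inv_mul_lt_iff₀ ht] at hv
        linarith
      · rw [hNX.smul_eq, abs_of_pos ht]
        nlinarith
      · rw [map_smul, hxv, smul_inv_smul₀ ht.ne']
  have hvol : ∀ t, 0 < t → volume (G t) = ENNReal.ofReal (t ^ m) * volume (G 1) := by
    intro t ht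
    rw [hsmul t ht, Measure.addHaar_smul, Module.finrank_fin_fun, abs_of_pos (by positivity)]
  have hpos : 0 < volume (G 1) := by
    refine (hopen 1 one_pos).measure_pos _ ⟨0, ?_, 0, ?_, map_zero _⟩
    · simpa using hR0
    · rw [hN0]; exact one_pos
  have hfin : volume (G 1) < ⊤ := by
    refine lt_of_le_of_lt (measure_mono (t := Metric.ball 0 (R * 1)) ?_) measure_ball_lt_top
    rintro v ⟨hv, -⟩
    simpa using hv
  set t : ℝ := δ * 2 ^ (-(1 / p)) with ht
  have ht0 : 0 < t := by positivity
  have htp : t ^ p = δ ^ p / 2 := by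
    rw [ht, Real.mul_rpow hδ0.le (by positivity), ← Real.rpow_mul (by norm_num)]
    rw [show -(1 / p) * p = -1 by field_simp, Real.rpow_neg_one]; ring
  have hδp : δ ^ p ≤ 1 := Real.rpow_le_one hδ0.le hδ1 hp0.le
  set u : ℝ := 2 ^ (1 / p) with hu
  have hu0 : 0 < u := by positivity
  have hup : u ^ p = 2 := by
    rw [hu, ← Real.rpow_mul (by norm_num), show 1 / p * p = 1 by field_simp, Real.rpow_one]
  have hdisj : (S : Set X).PairwiseDisjoint fun x => (fun v => v + -π x) ⁻¹' G t := by
    intro x hx y hy hxy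
    rw [Function.onFun, Set.disjoint_left]
    intro v hv1 hv2
    have := hadd t t δ ht0 ht0 hδ0 (by rw [htp]; linarith) _ hv2 _ (hGneg _ _ hv1)
    obtain ⟨-, z, hz, hz2⟩ := this
    refine hsep x hx y hy hxy z hz ?_
    rw [hz2]; dsimp only; abel
  have hsub : (⋃ x ∈ S, (fun v => v + -π x) ⁻¹' G t) ⊆ G u := by
    intro v hv
    simp only [Set.mem_iUnion] at hv
    obtain ⟨x, hx, hv⟩ := hv
    have := hadd 1 t u one_pos ht0 hu0 (by rw [htp, hup, Real.one_rpow]; linarith) (π x)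
      ⟨by simpa using hR x hx, x, hS x hx, rfl⟩ _ hv
    simpa using this
  have hle := measure_mono (μ := volume) hsub
  rw [measure_biUnion_finset hdisj
    (fun x _ => ((hopen t ht0).measurableSet.preimage (measurable_add_const _)))] at hle
  simp only [measure_preimage_add_right] at hle
  rw [Finset.sum_const, nsmul_eq_mul, hvol t ht0, hvol u hu0, ← mul_assoc,
    ENNReal.mul_le_mul_iff_left hpos.ne' hfin.ne, ← ENNReal.ofReal_natCast,
    ← ENNReal.ofReal_mul (by positivity), ENNReal.ofReal_le_ofReal_iff (by positivity)] at hle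
  have key : (2 : ℝ) ^ (2 / p) / δ = u / t := by
    rw [hu, ht, Real.rpow_neg (by norm_num), show 2 / p = 1 / p + 1 / p by ring,
      Real.rpow_add (by norm_num)]
    field_simp
  rw [key, div_pow, le_div_iff₀ (by positivity)]
  exact hle

/-- Net lemma. -/
lemma carl_net {X : Type*} [AddCommGroup X] [Module ℝ X] {p : ℝ} (hp0 : 0 < p) (hp1 : p ≤ 1)
    {NX : X → ℝ} (hNX : IsPNorm p NX) (M : Submodule ℝ X) (k : ℕ)
    (hM : Module.rank ℝ (X ⧸ M) < (k : Cardinal))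
    {δ : ℝ} (hδ0 : 0 < δ) (hδ1 : δ ≤ 1) :
    ∃ S : Finset X, (S.card : ℝ) ≤ ((2 : ℝ) ^ (2 / p) / δ) ^ k ∧ (∀ x ∈ S, NX x < 1) ∧
      ∀ x, NX x < 1 → ∃ s ∈ S, ∃ z, NX z < δ ∧ x - s - z ∈ M := by
  classical
  have hN0 : NX 0 = 0 := (hNX.eq_zero_iff 0).2 rfl
  have hneg : ∀ x, NX (-x) = NX x := fun x => by
    have := hNX.smul_eq (-1) x
    simpa using this
  have hfd : Module.Finite ℝ (X ⧸ M) := by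
    rw [← Module.rank_lt_aleph0_iff]
    exact hM.trans (Cardinal.natCast_lt_aleph0)
  have hmk : Module.finrank ℝ (X ⧸ M) ≤ k := by
    rw [← Module.finrank_eq_rank, Nat.cast_lt] at hM
    exact hM.le
  set m := Module.finrank ℝ (X ⧸ M) with hm
  let e := (Module.finBasis ℝ (X ⧸ M)).equivFun
  let π : X →ₗ[ℝ] (Fin m → ℝ) := e.toLinearMap ∘ₗ M.mkQ
  have hπ : Function.Surjective π := e.surjective.comp M.mkQ_surjective
  have hker : ∀ x, π x = 0 → x ∈ M := by
    intro x hx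
    have : M.mkQ x = 0 := e.injective (by rw [map_zero]; exact hx)
    simpa using this
  let Good : Finset X → Prop := fun S => (∀ x ∈ S, NX x < 1) ∧
    (∀ x ∈ S, ∀ y ∈ S, x ≠ y → ∀ z, NX z < δ → π z ≠ π x - π y)
  have hone : 1 ≤ (2 : ℝ) ^ (2 / p) / δ := by
    rw [le_div_iff₀ hδ0, one_mul]
    exact hδ1.trans (Real.one_le_rpow (by norm_num) (by positivity))
  have hb : ∀ S, Good S → (S.card : ℝ) ≤ ((2 : ℝ) ^ (2 / p) / δ) ^ k := fun S hS =>
    (carl_sep_bound hp0 hp1 hNX π hπ hδ0 hδ1 S hS.1 hS.2).trans (pow_le_pow_right₀ hone hmk)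
  have hP : ∃ S, Good S ∧ ∀ S', Good S' → S'.card ≤ S.card := by
    have hbdd : BddAbove {n | ∃ S, Good S ∧ S.card = n} := by
      refine ⟨⌊((2 : ℝ) ^ (2 / p) / δ) ^ k⌋₊, ?_⟩
      rintro _ ⟨S, hS, rfl⟩
      exact Nat.le_floor (hb S hS)
    have hne : {n | ∃ S, Good S ∧ S.card = n}.Nonempty := ⟨0, ∅, by simp [Good], rfl⟩
    obtain ⟨S, hS, hc⟩ := Nat.sSup_mem hne hbdd
    refine ⟨S, hS, fun S' hS' => ?_⟩
    rw [hc]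
    exact le_csSup hbdd ⟨S', hS', rfl⟩
  obtain ⟨S, hS, hmax⟩ := hP
  refine ⟨S, hb S hS, hS.1, fun x hx => ?_⟩
  by_contra! hcon
  have hcon' : ∀ s ∈ S, ∀ z, NX z < δ → π z ≠ π x - π s := by
    intro s hs z hz h
    refine hcon s hs z hz (hker _ ?_)
    rw [map_sub, map_sub, h, sub_self]
  have hxS : x ∉ S := fun h => hcon' x h 0 (by rwa [hN0]) (by simp)
  have hgood : Good (insert x S) := by
    constructor
    · intro y hy
      rcases Finset.mem_insert.1 hy with rfl | hy
      · exact hx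
      · exact hS.1 y hy
    · intro a ha b hb hab z hz
      rcases Finset.mem_insert.1 ha with rfl | ha' <;>
        rcases Finset.mem_insert.1 hb with rfl | hb'
      · exact absurd rfl hab
      · exact hcon' b hb' z hz
      · intro h
        refine hcon' a ha' (-z) (by rwa [hneg]) ?_
        rw [map_neg, h]; abel
      · exact hS.2 a ha' b hb' hab z hz
  have := hmax _ hgood
  rw [Finset.card_insert_of_notMem hxS] at this
  omega

/-- Covering statement: at most `2^b` centers, `q`-th power of the radius at most `ε`. -/
def CarlCov {X Y : Type*} [AddCommGroup X] [Module ℝ X] [AddCommGroup Y] [Module ℝ Y]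
    (NX : X → ℝ) (NY : Y → ℝ) (q : ℝ) (T : X →ₗ[ℝ] Y) (b ε : ℝ) : Prop :=
  ∃ S : Finset Y, (S.card : ℝ) ≤ (2 : ℝ) ^ b ∧ ∀ x, NX x < 1 → ∃ y ∈ S, NY (T x - y) ^ q ≤ ε

lemma carl_step {X Y : Type*} [AddCommGroup X] [Module ℝ X] [AddCommGroup Y] [Module ℝ Y]
    {p q : ℝ} (hp0 : 0 < p) (hp1 : p ≤ 1) (hq0 : 0 < q)
    {NX : X → ℝ} {NY : Y → ℝ} (hNX : IsPNorm p NX) (hNY : IsPNorm q NY)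
    (T : X →ₗ[ℝ] Y) (M : Submodule ℝ X) (k : ℕ)
    (hM : Module.rank ℝ (X ⧸ M) < (k : Cardinal)) {c : ℝ}
    (hc : ∀ x ∈ M, NX x ≤ 1 → NY (T x) ≤ c) {γ : ℝ} (hγ : 0 ≤ γ) {b ε : ℝ}
    (h : CarlCov NX NY q T b ε) :
    CarlCov NX NY q T (b + k * (2 / p + γ))
      ((2 : ℝ) ^ (2 * q / p) * c ^ q + (2 : ℝ) ^ (-(γ * q)) * ε) := by
  classical
  obtain ⟨S₁, hS₁, hcov₁⟩ := h
  have hneg : ∀ x, NX (-x) = NX x := fun x => by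
    have := hNX.smul_eq (-1) x
    simpa using this
  set δ : ℝ := (2 : ℝ) ^ (-γ) with hδ
  have hδ0 : 0 < δ := by positivity
  have hδ1 : δ ≤ 1 := Real.rpow_le_one_of_one_le_of_nonpos (by norm_num) (by linarith)
  obtain ⟨S, hS, hS1, hcov⟩ := carl_net hp0 hp1 hNX M k hM hδ0 hδ1
  have hc0 : 0 ≤ c := by
    have h0 := hc 0 M.zero_mem (by rw [(hNX.eq_zero_iff 0).2 rfl]; exact zero_le_one)
    exact (hNY.nonneg _).trans h0
  refine ⟨(S ×ˢ S₁).image (fun a => T a.1 + δ • a.2), ?_, ?_⟩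
  · have h1 : (((S ×ˢ S₁).image (fun a => T a.1 + δ • a.2)).card : ℝ) ≤ S.card * S₁.card := by
      rw [← Nat.cast_mul, ← Finset.card_product]
      exact_mod_cast Finset.card_image_le
    refine h1.trans ?_
    have h2 : ((2 : ℝ) ^ (2 / p) / δ) ^ k = (2 : ℝ) ^ (k * (2 / p + γ)) := by
      rw [hδ, ← Real.rpow_sub (by norm_num), sub_neg_eq_add, mul_comm, Real.rpow_mul (by norm_num),
        Real.rpow_natCast]
    rw [Real.rpow_add (by norm_num), mul_comm (_ ^ b), ← h2]
    exact mul_le_mul hS hS₁ (by positivity) (by positivity)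
  · intro x hx
    obtain ⟨s, hs, z, hz, hw⟩ := hcov x hx
    obtain ⟨y, hy, hy2⟩ := hcov₁ (δ⁻¹ • z) (by
      rw [hNX.smul_eq, abs_of_pos (inv_pos.2 hδ0), inv_mul_lt_iff₀ hδ0]; linarith)
    refine ⟨T s + δ • y, Finset.mem_image.2 ⟨(s, y), Finset.mem_product.2 ⟨hs, hy⟩, rfl⟩, ?_⟩
    set w := x - s - z with hwdef
    have hNw : NX w ^ p ≤ 4 := by
      have h1 := hNX.padd (x + -s) (-z)
      have h2 := hNX.padd x (-s)
      rw [hneg] at h1 h2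
      have e1 := Real.rpow_le_one (hNX.nonneg _) hx.le hp0.le
      have e2 := Real.rpow_le_one (hNX.nonneg _) (hS1 s hs).le hp0.le
      have e3 := Real.rpow_le_one (hNX.nonneg _) (hz.le.trans hδ1) hp0.le
      rw [hwdef, sub_eq_add_neg, sub_eq_add_neg]
      linarith
    have hK : (0 : ℝ) < 2 ^ (2 / p) := by positivity
    have hNw' : NX w ≤ 2 ^ (2 / p) := by
      rw [← Real.rpow_le_rpow_iff (hNX.nonneg _) hK.le hp0, ← Real.rpow_mul (by norm_num),
        show 2 / p * p = (2 : ℕ) by field_simp; norm_num, Real.rpow_natCast]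
      linarith
    have hTw : NY (T w) ≤ 2 ^ (2 / p) * c := by
      have h1 := hc (((2 : ℝ) ^ (2 / p))⁻¹ • w) (M.smul_mem _ hw) (by
        rw [hNX.smul_eq, abs_of_pos (inv_pos.2 hK), inv_mul_le_iff₀ hK]; linarith)
      rw [map_smul, hNY.smul_eq, abs_of_pos (inv_pos.2 hK), inv_mul_le_iff₀ hK] at h1
      exact h1
    have hTw' : NY (T w) ^ q ≤ 2 ^ (2 * q / p) * c ^ q := by
      refine (Real.rpow_le_rpow (hNY.nonneg _) hTw hq0.le).trans_eq ?_
      rw [Real.mul_rpow hK.le hc0, ← Real.rpow_mul (by norm_num)]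
      congr 2; ring
    have hdec : T x - (T s + δ • y) = T w + δ • (T (δ⁻¹ • z) - y) := by
      rw [smul_sub, map_smul, smul_inv_smul₀ hδ0.ne', hwdef, map_sub, map_sub]; abel
    rw [hdec]
    refine (hNY.padd _ _).trans (add_le_add hTw' ?_)
    rw [hNY.smul_eq, abs_of_pos hδ0, Real.mul_rpow hδ0.le (hNY.nonneg _), hδ,
      ← Real.rpow_mul (by norm_num), neg_mul]
    exact mul_le_mul_of_nonneg_left hy2 (by positivity)

lemma carl_iter {X Y : Type*} [AddCommGroup X] [Module ℝ X] [AddCommGroup Y] [Module ℝ Y]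
    {p q α : ℝ} (hp0 : 0 < p) (hp1 : p ≤ 1) (hq0 : 0 < q) (hα : 0 < α)
    {NX : X → ℝ} {NY : Y → ℝ} (hNX : IsPNorm p NX) (hNY : IsPNorm q NY)
    (T : X →ₗ[ℝ] Y) (n : ℕ) {D : ℝ} (hD : 0 < D)
    (hg : ∀ k : ℕ, 1 ≤ k → k ≤ n → ∃ M : Submodule ℝ X, Module.rank ℝ (X ⧸ M) < (k : Cardinal) ∧
      ∀ x ∈ M, NX x ≤ 1 → NY (T x) ≤ D * (k : ℝ) ^ (-α)) (s : ℕ) (hs : 2 ^ s ≤ n) :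
    CarlCov NX NY q T ((2 ^ (s + 1) - 2) * (2 / p + (α + 1 / q)))
      (2 * ((2 : ℝ) ^ (2 * q / p) * (D * ((2 : ℝ) ^ s) ^ (-α)) ^ q)) := by
  induction s with
  | zero =>
    obtain ⟨M, hM, hc⟩ := hg 1 le_rfl (by simpa using hs)
    have hMt : M = ⊤ := by
      rw [Nat.cast_one, Cardinal.lt_one_iff, rank_zero_iff] at hM
      exact Submodule.Quotient.subsingleton_iff.1 hM
    refine ⟨{0}, by simp, fun x hx => ⟨0, by simp, ?_⟩⟩
    have h1 := hc x (by rw [hMt]; trivial) hx.le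
    rw [sub_zero]
    have h2 := Real.rpow_le_rpow (hNY.nonneg _) h1 hq0.le
    simp only [Nat.cast_one, pow_zero, Real.one_rpow, mul_one] at h2 ⊢
    have h3 : (1 : ℝ) ≤ 2 ^ (2 * q / p) := Real.one_le_rpow (by norm_num) (by positivity)
    have h4 : 0 < D ^ q := by positivity
    nlinarith
  | succ s ih =>
    have ih := ih ((Nat.pow_le_pow_right (by norm_num) (Nat.le_succ s)).trans hs)
    obtain ⟨M, hM, hc⟩ := hg (2 ^ (s + 1)) Nat.one_le_two_pow hs
    have h := carl_step hp0 hp1 hq0 hNX hNY T M _ hM hc (γ := α + 1 / q) (by positivity) ih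
    convert h using 1
    · push_cast; ring
    · push_cast
      have e1 : (2 : ℝ) ^ (-((α + 1 / q) * q)) = 2 ^ (-(α * q)) / 2 := by
        rw [show -((α + 1 / q) * q) = -(α * q) - 1 by field_simp; ring,
          Real.rpow_sub (by norm_num), Real.rpow_one]
      have e2 : (D * ((2 : ℝ) ^ (s + 1)) ^ (-α)) ^ q
          = 2 ^ (-(α * q)) * (D * ((2 : ℝ) ^ s) ^ (-α)) ^ q := by
        rw [pow_succ, Real.mul_rpow (x := (2 : ℝ) ^ s) (by positivity) (by norm_num), ← mul_assoc,
          Real.mul_rpow (x := D * _) (by positivity) (by positivity),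
          ← Real.rpow_mul (x := 2) (by norm_num)]
        rw [neg_mul, mul_comm]
      rw [e1, e2]; ring

lemma carl_entropy_le {X Y : Type*} [AddCommGroup X] [Module ℝ X] [AddCommGroup Y] [Module ℝ Y]
    {q : ℝ} (hq0 : 0 < q) {NX : X → ℝ} {NY : Y → ℝ} (hNY : IsPNorm q NY)
    (T : X →ₗ[ℝ] Y) (k : ℕ) (hk : 1 ≤ k) {b ε r : ℝ} (hb : b ≤ k - 1) (hr : 0 < r)
    (hε : ε < r ^ q) (h : CarlCov NX NY q T b ε) : entropyNumber NX NY T k ≤ r := by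
  obtain ⟨S, hS, hcov⟩ := h
  refine csInf_le ⟨0, fun x hx => hx.1.le⟩ ⟨hr, ?_⟩
  have hcard : S.card ≤ 2 ^ (k - 1) := by
    have : (2 : ℝ) ^ b ≤ 2 ^ (k - 1) := by
      rw [← Real.rpow_natCast, Nat.cast_sub hk, Nat.cast_one]
      exact Real.rpow_le_rpow_of_exponent_le (by norm_num) hb
    exact_mod_cast hS.trans this
  let e := S.equivFin
  refine ⟨fun i => if hi : (i : ℕ) < S.card then (e.symm ⟨i, hi⟩ : Y) else 0, fun x hx => ?_⟩
  obtain ⟨y, hy, hy2⟩ := hcov x hx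
  refine ⟨⟨e ⟨y, hy⟩, (e ⟨y, hy⟩).2.trans_le hcard⟩, ?_⟩
  have : NY (T x - y) < r := by
    rw [← Real.rpow_lt_rpow_iff (hNY.nonneg _) hr.le hq0]
    exact hy2.trans_lt hε
  simpa using this

lemma carl_main {X Y : Type*} [AddCommGroup X] [Module ℝ X] [AddCommGroup Y] [Module ℝ Y]
    {p q α : ℝ} (hp0 : 0 < p) (hp1 : p ≤ 1) (hq0 : 0 < q) (hα : 0 < α)
    {NX : X → ℝ} {NY : Y → ℝ} (hNX : IsPNorm p NX) (hNY : IsPNorm q NY)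
    (T : X →ₗ[ℝ] Y) (n : ℕ) {D : ℝ} (hD : 0 < D)
    (hg : ∀ k : ℕ, 1 ≤ k → k ≤ n → ∃ M : Submodule ℝ X, Module.rank ℝ (X ⧸ M) < (k : Cardinal) ∧
      ∀ x ∈ M, NX x ≤ 1 → NY (T x) ≤ D * (k : ℝ) ^ (-α)) (k : ℕ) (hk : 1 ≤ k) (hkn : k ≤ n) :
    (k : ℝ) ^ α * entropyNumber NX NY T k ≤
      (2 : ℝ) ^ (2 * α + 3 / q + 2 / p) * (2 / p + α + 1 / q + 2) ^ α * D := by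
  set A : ℝ := 2 / p + α + 1 / q + 2 with hA
  have hA0 : 2 ≤ A := by
    have : 0 < 2 / p + α + 1 / q := by positivity
    linarith
  have hk1 : (1 : ℝ) ≤ k := by exact_mod_cast hk
  obtain ⟨s, hsk, hks, hbits⟩ : ∃ s : ℕ, 2 ^ s ≤ k ∧ (k : ℝ) ≤ 4 * A * 2 ^ s ∧
      ((2 : ℝ) ^ (s + 1) - 2) * (2 / p + (α + 1 / q)) ≤ k - 1 := by
    by_cases h : (k : ℝ) ≤ 2 * A
    · exact ⟨0, by simpa using hk, by simp; linarith, by norm_num; linarith⟩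
    · push Not at h
      obtain ⟨s, hs1, hs2⟩ := exists_nat_pow_near (x := (k : ℝ) / (2 * A)) (y := 2)
        (by rw [le_div_iff₀ (by positivity)]; linarith) (by norm_num)
      rw [le_div_iff₀ (by positivity)] at hs1
      rw [div_lt_iff₀ (by positivity), pow_succ] at hs2
      have h2s : (1 : ℝ) ≤ 2 ^ s := one_le_pow₀ (by norm_num)
      refine ⟨s, ?_, by linarith, ?_⟩
      · have : (2 : ℝ) ^ s ≤ k := by nlinarith
        exact_mod_cast this
      · rw [show 2 / p + (α + 1 / q) = A - 2 by rw [hA]; ring, pow_succ]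
        nlinarith
  have hcov := carl_iter hp0 hp1 hq0 hα hNX hNY T n hD hg s (hsk.trans hkn)
  set E : ℝ := D * ((2 : ℝ) ^ s) ^ (-α) with hE
  have hE0 : 0 < E := by positivity
  have hent : entropyNumber NX NY T k ≤ 2 ^ (3 / q + 2 / p) * E := by
    refine carl_entropy_le hq0 hNY T k hk hbits (by positivity) ?_ hcov
    rw [Real.mul_rpow (by positivity) hE0.le, ← Real.rpow_mul (by norm_num), ← mul_assoc,
      show (3 / q + 2 / p) * q = (3 : ℕ) + 2 * q / p by field_simp; norm_num; ring,
      Real.rpow_add (by norm_num), Real.rpow_natCast]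
    have h1 : (0 : ℝ) < 2 ^ (2 * q / p) := by positivity
    have h2 : 0 < E ^ q := by positivity
    have := mul_pos h1 h2
    nlinarith
  have hkα : (k : ℝ) ^ α ≤ 2 ^ (2 * α) * A ^ α * ((2 : ℝ) ^ s) ^ α := by
    refine (Real.rpow_le_rpow (by positivity) hks hα.le).trans_eq ?_
    rw [Real.mul_rpow (by positivity) (by positivity), Real.mul_rpow (by norm_num) (by positivity),
      Real.rpow_mul (by norm_num)]
    norm_num
  refine (mul_le_mul hkα hent (Real.sInf_nonneg fun x hx => hx.1.le) (by positivity)).trans_eq ?_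
  have hcancel : ((2 : ℝ) ^ s) ^ α * ((2 : ℝ) ^ s) ^ (-α) = 1 := by
    rw [← Real.rpow_add (by positivity), add_neg_cancel, Real.rpow_zero]
  rw [show 2 * α + 3 / q + 2 / p = 2 * α + (3 / q + 2 / p) by ring,
    Real.rpow_add (by norm_num) (2 * α), hE]
  linear_combination (2 ^ (2 * α) * A ^ α * 2 ^ (3 / q + 2 / p) * D) * hcancel

/-- **Carl's inequality with explicit constant.** For `0 < p,q ≤ 1`, `α > 0`, every
bounded linear operator `T` from a `p`-normed space `X` to a `q`-normed space `Y`, and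
every `n ∈ ℕ`, `sup_{1 ≤ k ≤ n} k^α e_k(T) ≤ 2^{2α+3/q+2/p} (2/p+α+1/q+2)^α ⬝
sup_{1 ≤ k ≤ n} k^α c_k(T)`. -/
theorem carl_inequality_explicit_constant {X Y : Type*}
    [AddCommGroup X] [Module ℝ X] [AddCommGroup Y] [Module ℝ Y]
    (p q α : ℝ) (hp0 : 0 < p) (hp1 : p ≤ 1) (hq0 : 0 < q) (hq1 : q ≤ 1) (hα : 0 < α)
    (NX : X → ℝ) (NY : Y → ℝ) (hNX : IsPNorm p NX) (hNY : IsPNorm q NY)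
    (T : X →ₗ[ℝ] Y) (hT : ∃ C : ℝ, ∀ x, NX x ≤ 1 → NY (T x) ≤ C) (n : ℕ) :
    sSup ((fun k : ℕ => (k : ℝ) ^ α * entropyNumber NX NY T k) '' Set.Icc 1 n)
      ≤ (2 : ℝ) ^ (2 * α + 3 / q + 2 / p) * (2 / p + α + 1 / q + 2) ^ α *
        sSup ((fun k : ℕ => (k : ℝ) ^ α * gelfandNumber NX NY T k) '' Set.Icc 1 n) := by
  rcases Nat.eq_zero_or_pos n with rfl | hn
  · simp
  set G := sSup ((fun k : ℕ => (k : ℝ) ^ α * gelfandNumber NX NY T k) '' Set.Icc 1 n) with hG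
  have hbdd : BddAbove ((fun k : ℕ => (k : ℝ) ^ α * gelfandNumber NX NY T k) '' Set.Icc 1 n) :=
    ((Set.finite_Icc 1 n).image _).bddAbove
  have hle : ∀ k : ℕ, 1 ≤ k → k ≤ n → (k : ℝ) ^ α * gelfandNumber NX NY T k ≤ G :=
    fun k h1 h2 => le_csSup hbdd ⟨k, ⟨h1, h2⟩, rfl⟩
  have hN0 : NX 0 = 0 := (hNX.eq_zero_iff 0).2 rfl
  have hG0 : 0 ≤ G := by
    refine le_trans ?_ (hle 1 le_rfl hn)
    refine mul_nonneg (by positivity) (Real.sInf_nonneg ?_)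
    rintro r ⟨M, -, hM⟩
    exact (hNY.nonneg _).trans (hM 0 M.zero_mem (by rw [hN0]; exact zero_le_one))
  have hmain : ∀ D, G < D → ∀ k : ℕ, 1 ≤ k → k ≤ n → (k : ℝ) ^ α * entropyNumber NX NY T k ≤
      (2 : ℝ) ^ (2 * α + 3 / q + 2 / p) * (2 / p + α + 1 / q + 2) ^ α * D := by
    intro D hD k hk hkn
    refine carl_main hp0 hp1 hq0 hα hNX hNY T n (hG0.trans_lt hD) ?_ k hk hkn
    intro j hj hjn
    have hj0 : (0 : ℝ) < j := by exact_mod_cast hj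
    have hlt : gelfandNumber NX NY T j < D * (j : ℝ) ^ (-α) := by
      rw [Real.rpow_neg hj0.le, ← div_eq_mul_inv, lt_div_iff₀ (by positivity), mul_comm]
      exact (hle j hj hjn).trans_lt hD
    obtain ⟨C, hC⟩ := hT
    have hne : {r : ℝ | ∃ M : Submodule ℝ X, Module.rank ℝ (X ⧸ M) < (j : Cardinal) ∧
        ∀ x ∈ M, NX x ≤ 1 → NY (T x) ≤ r}.Nonempty := by
      refine ⟨C, ⊤, ?_, fun x _ hx => hC x hx⟩
      rw [rank_zero_iff.2 (Submodule.Quotient.subsingleton_iff.2 rfl)]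
      exact_mod_cast hj
    obtain ⟨r, ⟨M, hM, hr⟩, hrD⟩ := exists_lt_of_csInf_lt hne hlt
    exact ⟨M, hM, fun x hx hx1 => (hr x hx hx1).trans hrD.le⟩
  refine csSup_le ((Set.nonempty_Icc.2 hn).image _) ?_
  rintro _ ⟨k, ⟨hk1, hkn⟩, rfl⟩
  have hK : 0 < (2 : ℝ) ^ (2 * α + 3 / q + 2 / p) * (2 / p + α + 1 / q + 2) ^ α := by positivity
  rw [← div_le_iff₀' hK]
  refine le_of_forall_gt_imp_ge_of_dense fun D hD => ?_
  rw [div_le_iff₀' hK]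
  exact hmain D hD k hk1 hkn
end

section
/- Let 0 < p ≤ 1, let m ≥ 1 be a natural number, and let X be an m-dimensional real vector space equipped with a p-norm ‖·‖_X. Then for every n ∈ ℕ there exist points x_1,…,x_{2^{n-1}} ∈ X such that B_X ⊆ ⋃_{i=1}^{2^{n-1}} (x_i + 4^{1/p} · 2^{-(n-1)/m} · B_X); equivalently, the n-th entropy number of the identity map of X satisfies e_n(id : X → X) ≤ 4^{1/p} · 2^{-(n-1)/m}. -/
open MeasureTheory
open scoped Pointwise

theorem pn_zero {X : Type*} [AddCommGroup X] [Module ℝ X] {p : ℝ} {N : X → ℝ}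
    (h : IsPNorm p N) : N 0 = 0 := (h.eq_zero_iff 0).2 rfl

theorem pn_neg {X : Type*} [AddCommGroup X] [Module ℝ X] {p : ℝ} {N : X → ℝ}
    (h : IsPNorm p N) (x : X) : N (-x) = N x := by
  have := h.smul_eq (-1) x
  simpa using this

theorem pn_sum {X : Type*} [AddCommGroup X] [Module ℝ X] {p : ℝ} (hp0 : 0 < p) {N : X → ℝ}
    (h : IsPNorm p N) {ι : Type*} (s : Finset ι) (f : ι → X) :
    N (∑ i ∈ s, f i) ^ p ≤ ∑ i ∈ s, N (f i) ^ p := by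
  classical
  induction s using Finset.induction_on with
  | empty => simp [pn_zero h, Real.zero_rpow hp0.ne']
  | insert a s ha ih =>
    rw [Finset.sum_insert ha, Finset.sum_insert ha]
    exact (h.padd _ _).trans (by linarith)

theorem pn_continuous {m : ℕ} {p : ℝ} (hp0 : 0 < p) {N : (Fin m → ℝ) → ℝ}
    (h : IsPNorm p N) : Continuous N := by
  have hf : Continuous (fun x => N x ^ p) := by
    set g : (Fin m → ℝ) → ℝ := fun x => ∑ i, |x i| ^ p * N (Pi.single i 1) ^ p with hg
    have hgc : Continuous g := by
      refine continuous_finsetSum _ fun i _ => Continuous.mul ?_ continuous_const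
      exact ((continuous_apply i).abs).rpow_const (fun x => Or.inr hp0.le)
    have hg0 : g 0 = 0 := by simp [hg, Real.zero_rpow hp0.ne']
    have hfg : ∀ x, N x ^ p ≤ g x := by
      intro x
      have hx : x = ∑ i, x i • (Pi.single i 1 : Fin m → ℝ) := by
        funext j
        simp [Finset.sum_apply, Pi.single_apply]
      calc N x ^ p = N (∑ i, x i • (Pi.single i 1 : Fin m → ℝ)) ^ p := by rw [← hx]
        _ ≤ ∑ i, N (x i • (Pi.single i 1 : Fin m → ℝ)) ^ p := pn_sum hp0 h _ _
        _ = g x := by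
          refine Finset.sum_congr rfl fun i _ => ?_
          rw [h.smul_eq, Real.mul_rpow (abs_nonneg _) (h.nonneg _)]
    have hd : ∀ x y, |N x ^ p - N y ^ p| ≤ g (x - y) := by
      intro x y
      have h1 := h.padd (x - y) y
      have h2 := h.padd (-(x - y)) x
      rw [pn_neg h] at h2
      have e1 : x - y + y = x := by abel
      have e2 : -(x - y) + x = y := by abel
      rw [e1] at h1
      rw [e2] at h2
      have := hfg (x - y)
      rw [abs_le]
      constructor <;> linarith
    rw [continuous_iff_continuousAt]
    intro y
    rw [ContinuousAt, tendsto_iff_dist_tendsto_zero]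
    have hl : Filter.Tendsto (fun x => g (x - y)) (nhds y) (nhds 0) := by
      have : Continuous (fun x => g (x - y)) := hgc.comp (continuous_id.sub continuous_const)
      have := this.tendsto y
      simpa [hg0] using this
    exact squeeze_zero (fun _ => dist_nonneg) (fun x => by rw [Real.dist_eq]; exact hd x y) hl
  have : N = fun x => (N x ^ p) ^ (1 / p) := by
    funext x
    rw [← Real.rpow_mul (h.nonneg x), mul_one_div_cancel hp0.ne', Real.rpow_one]
  rw [this]
  exact hf.rpow_const (fun x => Or.inr (by positivity))

theorem pn_lower {m : ℕ} (hm : 1 ≤ m) {p : ℝ} (hp0 : 0 < p) {N : (Fin m → ℝ) → ℝ}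
    (h : IsPNorm p N) : ∃ c : ℝ, 0 < c ∧ ∀ x, c * ‖x‖ ≤ N x := by
  have : Nonempty (Fin m) := ⟨⟨0, hm⟩⟩
  obtain ⟨z, hz, hmin⟩ := (isCompact_sphere (0 : Fin m → ℝ) 1).exists_isMinOn
    (NormedSpace.sphere_nonempty.2 zero_le_one) (pn_continuous hp0 h).continuousOn
  have hz1 : ‖z‖ = 1 := by simpa using hz
  have hz0 : z ≠ 0 := by
    rintro rfl
    simp at hz1
  refine ⟨N z, lt_of_le_of_ne (h.nonneg z) (fun e => hz0 ((h.eq_zero_iff z).1 e.symm)), ?_⟩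
  intro x
  by_cases hx : x = 0
  · subst hx
    simp [pn_zero h]
  have hx' : 0 < ‖x‖ := norm_pos_iff.2 hx
  have hs : ‖x‖⁻¹ • x ∈ Metric.sphere (0 : Fin m → ℝ) 1 := by
    simp [norm_smul, hx'.ne']
  have := hmin hs
  simp only [Set.mem_ofPred_eq] at this
  rw [h.smul_eq, abs_of_pos (inv_pos.2 hx')] at this
  calc N z * ‖x‖ ≤ (‖x‖⁻¹ * N x) * ‖x‖ := by gcongr
    _ = N x := by field_simp

theorem pn_vol {m : ℕ} {p : ℝ} {N : (Fin m → ℝ) → ℝ}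
    (h : IsPNorm p N) {r : ℝ} (hr : 0 < r) (x : Fin m → ℝ) :
    volume {y | N (y - x) < r} = ENNReal.ofReal (r ^ m) * volume {y | N y < 1} := by
  have e1 : {y | N (y - x) < r} = (fun y => y + (-x)) ⁻¹' {y | N y < r} := by
    ext y
    simp [sub_eq_add_neg]
  have e2 : {y | N y < r} = r • {y | N y < 1} := by
    ext y
    rw [Set.mem_smul_set_iff_inv_smul_mem₀ hr.ne']
    simp only [Set.mem_ofPred_eq]
    rw [h.smul_eq, abs_of_pos (inv_pos.2 hr), inv_mul_lt_iff₀ hr, mul_one]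
  rw [e1, measure_preimage_add_right, e2, Measure.addHaar_smul]
  simp [abs_of_pos hr]

theorem pn_packing {m : ℕ} (hm : 1 ≤ m) {p : ℝ} (hp0 : 0 < p) {N : (Fin m → ℝ) → ℝ}
    (h : IsPNorm p N) {r R : ℝ} (hr : 0 < r) (hR : 0 < R)
    (hrR : R ^ p = 1 + r ^ p) (S : Finset (Fin m → ℝ)) (hS : ∀ x ∈ S, N x < 1)
    (hsep : ∀ x ∈ S, ∀ y ∈ S, x ≠ y → 2 * r ^ p ≤ N (x - y) ^ p) :
    (S.card : ℝ) * r ^ m ≤ R ^ m := by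
  have hc := pn_continuous hp0 h
  have hpos : volume {y | N y < 1} ≠ 0 := by
    have ho : IsOpen {y | N y < 1} := isOpen_lt hc continuous_const
    exact (ho.measure_pos volume ⟨0, by simp [pn_zero h]⟩).ne'
  have hfin : volume {y | N y < 1} ≠ ⊤ := by
    obtain ⟨c, hc0, hcl⟩ := pn_lower hm hp0 h
    refine ((measure_mono ?_).trans_lt (measure_closedBall_lt_top (x := (0 : Fin m → ℝ)) (r := c⁻¹))).ne
    intro y hy
    have hy' : N y < 1 := hy
    have := hcl y
    rw [mem_closedBall_zero_iff, ← one_div, le_div_iff₀ hc0]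
    linarith
  have hdisj : Set.PairwiseDisjoint (S : Set (Fin m → ℝ)) (fun x => {y | N (y - x) < r}) := by
    intro x hx y hy hxy
    refine Set.disjoint_left.2 fun z hz1 hz2 => ?_
    have hz1' : N (z - x) < r := hz1
    have hz2' : N (z - y) < r := hz2
    have h1 := Real.rpow_lt_rpow (h.nonneg _) hz1' hp0
    have h2 := Real.rpow_lt_rpow (h.nonneg _) hz2' hp0
    have h3 := h.padd (-(z - x)) (z - y)
    rw [pn_neg h] at h3
    have e : -(z - x) + (z - y) = x - y := by abel
    rw [e] at h3
    have := hsep x hx y hy hxy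
    linarith
  have hmeas : ∀ x ∈ S, MeasurableSet {y | N (y - x) < r} := fun x _ =>
    (isOpen_lt (hc.comp (continuous_id.sub continuous_const)) continuous_const).measurableSet
  have hsub : (⋃ x ∈ S, {y | N (y - x) < r}) ⊆ {y | N (y - 0) < R} := by
    intro y hy
    simp only [Set.mem_iUnion] at hy
    obtain ⟨x, hx, hyx⟩ := hy
    have hyx' : N (y - x) < r := hyx
    have h1 := Real.rpow_lt_rpow (h.nonneg _) hyx' hp0
    have h2 := Real.rpow_lt_rpow (h.nonneg _) (hS x hx) hp0
    rw [Real.one_rpow] at h2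
    have h3 := h.padd (y - x) x
    rw [sub_add_cancel] at h3
    have : N y ^ p < R ^ p := by linarith
    simpa using (Real.rpow_lt_rpow_iff (h.nonneg _) hR.le hp0).1 this
  have key := measure_mono (μ := volume) hsub
  rw [measure_biUnion_finset hdisj hmeas, Finset.sum_congr rfl (fun x _ => pn_vol h hr x),
    pn_vol h hR, Finset.sum_const, nsmul_eq_mul, ← mul_assoc,
    ENNReal.mul_le_mul_iff_left hpos hfin] at key
  have e : ((S.card : ENNReal)) = ENNReal.ofReal (S.card : ℝ) := by simp
  rw [e, ← ENNReal.ofReal_mul (by positivity), ENNReal.ofReal_le_ofReal_iff (by positivity)] at key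
  exact key

theorem exists_net {V : Type*} (d : V → V → Prop) (B : V → Prop) (hd : ∀ x y, d x y → d y x)
    (v : V) (M : ℕ) (hM : 0 < M)
    (hcard : ∀ S : Finset V, (∀ x ∈ S, B x) → (∀ x ∈ S, ∀ y ∈ S, x ≠ y → d x y) → S.card ≤ M)
    (hirr : ∀ x, ¬ d x x) :
    ∃ c : Fin M → V, ∀ y, B y → ∃ i, ¬ d y (c i) := by
  classical
  let P : ℕ → Prop := fun k => ∃ S : Finset V, S.card = k ∧ (∀ x ∈ S, B x) ∧
    (∀ x ∈ S, ∀ y ∈ S, x ≠ y → d x y)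
  have hP0 : P 0 := ⟨∅, by simp⟩
  obtain ⟨S, hSc, hSB, hSd⟩ : P (Nat.findGreatest P M) := Nat.findGreatest_spec (Nat.zero_le M) hP0
  have hle := hcard S hSB hSd
  have hcov : ∀ y, B y → ∃ x ∈ S, ¬ d y x := by
    intro y hy
    by_contra! hcon
    have hyS : y ∉ S := fun hyS => hirr y (hcon y hyS)
    have hB' : ∀ x ∈ insert y S, B x := by
      intro x hx
      rcases Finset.mem_insert.1 hx with rfl | hx
      · exact hy
      · exact hSB x hx
    have hd' : ∀ x ∈ insert y S, ∀ z ∈ insert y S, x ≠ z → d x z := by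
      intro x hx z hz hxz
      rcases Finset.mem_insert.1 hx with hx | hx <;> rcases Finset.mem_insert.1 hz with hz | hz
      · exact absurd (hx.trans hz.symm) hxz
      · rw [hx]
        exact hcon z hz
      · rw [hz]
        exact hd _ _ (hcon x hx)
      · exact hSd x hx z hz hxz
    have hc' := hcard _ hB' hd'
    rw [Finset.card_insert_of_notMem hyS] at hc'
    have : S.card + 1 ≤ Nat.findGreatest P M :=
      Nat.le_findGreatest hc' ⟨insert y S, Finset.card_insert_of_notMem hyS, hB', hd'⟩
    omega
  refine ⟨fun i => if hi : (i : ℕ) < S.card then (S.equivFin.symm ⟨i, hi⟩ : V) else v, ?_⟩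
  intro y hy
  obtain ⟨x, hx, hyx⟩ := hcov y hy
  refine ⟨⟨S.equivFin ⟨x, hx⟩, lt_of_lt_of_le (S.equivFin ⟨x, hx⟩).2 hle⟩, ?_⟩
  simpa using hyx

theorem pn_cover {m : ℕ} (hm : 1 ≤ m) {p : ℝ} (hp0 : 0 < p) {N : (Fin m → ℝ) → ℝ}
    (h : IsPNorm p N) (n : ℕ) :
    ∃ c : Fin (2 ^ (n - 1)) → (Fin m → ℝ), ∀ y, N y < 1 →
        ∃ i, N (y - c i) < (4 : ℝ) ^ (1 / p) * (2 : ℝ) ^ (-((n : ℝ) - 1) / m) := by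
  set a : ℝ := (2 : ℝ) ^ (-((n : ℝ) - 1) / m) with ha
  have ha0 : 0 < a := by positivity
  set ε : ℝ := (4 : ℝ) ^ (1 / p) * a with hε
  have hε0 : 0 < ε := by positivity
  have hm0 : (0 : ℝ) < m := by exact_mod_cast hm
  by_cases h1 : 1 ≤ ε
  · refine ⟨fun _ => 0, fun y hy => ⟨⟨0, by positivity⟩, ?_⟩⟩
    simpa using hy.trans_le h1
  push Not at h1
  have hn : 1 ≤ n := by
    by_contra hn
    have hn0 : n = 0 := by omega
    have : 1 ≤ a := by
      rw [ha, hn0]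
      exact Real.one_le_rpow (by norm_num) (by simp)
    have h4 : (1 : ℝ) ≤ (4 : ℝ) ^ (1 / p) := Real.one_le_rpow (by norm_num) (by positivity)
    have : 1 * 1 ≤ ε := mul_le_mul h4 this (by norm_num) (by positivity)
    linarith
  have ham : a ^ m * 2 ^ (n - 1) = 1 := by
    rw [ha, ← Real.rpow_natCast, ← Real.rpow_mul (by norm_num), div_mul_cancel₀ _ hm0.ne',
      ← Real.rpow_natCast, ← Real.rpow_add (by norm_num)]
    push_cast [hn]
    simp
  have hεp : ε ^ p = 4 * a ^ p := by
    rw [hε, Real.mul_rpow (by positivity) ha0.le, ← Real.rpow_mul (by norm_num),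
      one_div_mul_cancel hp0.ne', Real.rpow_one]
  have hεp1 : ε ^ p < 1 := Real.rpow_lt_one hε0.le h1 hp0
  have hap : 0 < a ^ p := by positivity
  set r : ℝ := (2 * a ^ p) ^ (1 / p) with hr
  have hr0 : 0 < r := by positivity
  have hrp : r ^ p = 2 * a ^ p := by
    rw [hr, ← Real.rpow_mul (by positivity), one_div_mul_cancel hp0.ne', Real.rpow_one]
  set R : ℝ := (1 + 2 * a ^ p) ^ (1 / p) with hR
  have hR0 : 0 < R := by positivity
  have hRp : R ^ p = 1 + r ^ p := by
    rw [hrp, hR, ← Real.rpow_mul (by positivity), one_div_mul_cancel hp0.ne', Real.rpow_one]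
  have hRr : a * R ≤ r := by
    rw [← Real.rpow_le_rpow_iff (by positivity) hr0.le hp0, Real.mul_rpow ha0.le hR0.le, hRp, hrp]
    nlinarith
  obtain ⟨c, hc⟩ := exists_net (fun x y => ε ≤ N (x - y)) (fun x => N x < 1)
    (fun x y hxy => by rw [← pn_neg h, neg_sub]; exact hxy) 0 (2 ^ (n - 1)) (by positivity)
    (by
      intro S hSB hSd
      have key := pn_packing hm hp0 h hr0 hR0 hRp S hSB (fun x hx y hy hxy => by
        have := Real.rpow_le_rpow hε0.le (hSd x hx y hy hxy) hp0.le
        rw [hrp]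
        linarith)
      have h2 : (a * R) ^ m ≤ r ^ m := by gcongr
      rw [mul_pow] at h2
      have hRm : 0 < R ^ m := by positivity
      have ham0 : 0 < a ^ m := by positivity
      have h3 : (S.card : ℝ) * (a ^ m * R ^ m) ≤ R ^ m :=
        (mul_le_mul_of_nonneg_left h2 (by positivity)).trans key
      have h4 : (S.card : ℝ) * a ^ m ≤ 1 := by
        rw [← mul_assoc] at h3
        exact (mul_le_iff_le_one_left hRm).1 h3
      rw [← ham, mul_comm] at h4
      have := le_of_mul_le_mul_left h4 ham0
      exact_mod_cast this)
    (fun x => by simpa [pn_zero h] using hε0)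
  exact ⟨c, fun y hy => by simpa using hc y hy⟩

/-- **Entropy numbers of the identity on an `m`-dimensional `p`-normed space.**
For every `n ∈ ℕ`, the open unit ball `B_X` can be covered by `2^(n-1)` translates of
`4^{1/p} 2^{-(n-1)/m} B_X`; equivalently `e_n(id : X → X) ≤ 4^{1/p} 2^{-(n-1)/m}`. -/
theorem entropy_identity_finiteDim {X : Type*} [AddCommGroup X] [Module ℝ X]
    [FiniteDimensional ℝ X] (p : ℝ) (hp0 : 0 < p) (hp1 : p ≤ 1)
    (m : ℕ) (hm : 1 ≤ m) (hdim : Module.finrank ℝ X = m)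
    (NX : X → ℝ) (hNX : IsPNorm p NX) (n : ℕ) :
    (∃ c : Fin (2 ^ (n - 1)) → X, ∀ y : X, NX y < 1 →
        ∃ i, NX (y - c i) < (4 : ℝ) ^ (1 / p) * (2 : ℝ) ^ (-((n : ℝ) - 1) / m)) ∧
      entropyNumber NX NX (LinearMap.id : X →ₗ[ℝ] X) n
        ≤ (4 : ℝ) ^ (1 / p) * (2 : ℝ) ^ (-((n : ℝ) - 1) / m) := by
  have hcov : ∃ c : Fin (2 ^ (n - 1)) → X, ∀ y : X, NX y < 1 →
      ∃ i, NX (y - c i) < (4 : ℝ) ^ (1 / p) * (2 : ℝ) ^ (-((n : ℝ) - 1) / m) := by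
    let e : (Fin m → ℝ) ≃ₗ[ℝ] X := LinearEquiv.ofFinrankEq _ _ (by simp [hdim])
    have hN : IsPNorm p (fun x => NX (e x)) :=
      { nonneg := fun x => hNX.nonneg _
        eq_zero_iff := fun x => by simp [hNX.eq_zero_iff]
        smul_eq := fun a x => by simp [hNX.smul_eq]
        padd := fun x y => by
          simp only [map_add]
          exact hNX.padd _ _ }
    obtain ⟨c, hc⟩ := pn_cover hm hp0 hN n
    refine ⟨fun i => e (c i), fun y hy => ?_⟩
    obtain ⟨i, hi⟩ := hc (e.symm y) (by simpa using hy)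
    exact ⟨i, by simpa using hi⟩
  refine ⟨hcov, csInf_le ⟨0, fun ε hε => hε.1.le⟩ ⟨by positivity, ?_⟩⟩
  simpa using hcov
end

section
/- Let 0 < p ≤ 1, let m ≥ 1 be a natural number, let X be an m-dimensional real vector space equipped with a p-norm ‖·‖_X, and let ε > 0. If x_1,…,x_K ∈ B_X satisfy ‖x_i − x_j‖_X ≥ ε for all i ≠ j, then K ≤ ( 2^{1/p} (1 + ε^p/2)^{1/p} / ε )^m. -/
open MeasureTheory Set Filter Topology in
theorem packing_aux (m : ℕ) (hm : 1 ≤ m) (p : ℝ) (hp0 : 0 < p)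
    (g : (Fin m → ℝ) → ℝ) (g0 : ∀ x, 0 ≤ g x) (gz : ∀ x, g x = 0 → x = 0)
    (gs : ∀ (a : ℝ) x, g (a • x) = |a| ^ p * g x)
    (ga : ∀ x y, g (x + y) ≤ g x + g y) (t : ℝ) (ht : 0 < t)
    (K : ℕ) (x : Fin K → Fin m → ℝ) (hball : ∀ i, g (x i) < 1)
    (hsep : ∀ i j, i ≠ j → 2 * t ≤ g (x i - x j)) :
    (K : ℝ) * (t ^ (1 / p)) ^ m ≤ ((1 + t) ^ (1 / p)) ^ m := by
  have gzero : g 0 = 0 := by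
    have := gs 0 0
    simpa [Real.zero_rpow hp0.ne'] using this
  have gneg : ∀ x, g (-x) = g x := fun x => by
    have := gs (-1) x
    simpa using this
  set h : (Fin m → ℝ) → ℝ := fun y => ∑ i, |y i| ^ p * g (Pi.single i 1) with hh
  have hcont : Continuous h := by
    refine continuous_finsetSum _ fun i _ => ?_
    exact (((continuous_apply i).abs).rpow_const fun _ => Or.inr hp0.le).mul continuous_const
  have h0 : h 0 = 0 := by simp [hh, Real.zero_rpow hp0.ne']
  have gh : ∀ y, g y ≤ h y := by
    intro y
    have e : y = ∑ i, y i • (Pi.single i (1 : ℝ) : Fin m → ℝ) := by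
      ext j; simp [Finset.sum_apply, Pi.single_apply]
    calc g y = g (∑ i, y i • (Pi.single i (1 : ℝ) : Fin m → ℝ)) := by rw [← e]
      _ ≤ ∑ i, g (y i • (Pi.single i (1 : ℝ) : Fin m → ℝ)) :=
        Finset.le_sum_of_subadditive g gzero.le ga _ _
      _ = h y := by simp [hh, gs]
  have gcont : Continuous g := by
    rw [continuous_iff_continuousAt]
    intro a
    rw [ContinuousAt, tendsto_iff_dist_tendsto_zero]
    have ht : Tendsto (fun y => h (y - a)) (𝓝 a) (𝓝 0) := by
      have : Continuous fun y => h (y - a) := hcont.comp (continuous_id.sub continuous_const)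
      have := this.tendsto a
      simpa [h0] using this
    refine squeeze_zero (fun _ => dist_nonneg) (fun y => ?_) ht
    refine le_trans ?_ (gh (y - a))
    rw [Real.dist_eq, abs_le]
    have h1 := ga (y - a) a
    have h2 := ga (a - y) y
    rw [← neg_sub y a, gneg, neg_sub] at h2
    simp only [sub_add_cancel] at h1 h2
    constructor <;> linarith
  set B : ℝ → Set (Fin m → ℝ) := fun s => {y | g y < s} with hB
  have Bopen : ∀ s, IsOpen (B s) := fun s => isOpen_lt gcont continuous_const
  have Bscale : ∀ s, 0 < s → volume (B s) = ENNReal.ofReal ((s ^ (1 / p)) ^ m) * volume (B 1) := by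
    intro s hs
    have hsp : 0 < s ^ (1 / p) := by positivity
    have e : B s = (fun y => (s ^ (1 / p))⁻¹ • y) ⁻¹' (B 1) := by
      ext y
      have : |(s ^ (1 / p))⁻¹| ^ p = s⁻¹ := by
        rw [abs_of_pos (by positivity), Real.inv_rpow hsp.le, ← Real.rpow_mul hs.le]
        simp [hp0.ne']
      simp only [hB, mem_ofPred_eq, mem_preimage, gs, this]
      rw [inv_mul_lt_iff₀ hs, mul_one]
    rw [e, Measure.addHaar_preimage_smul _ (by positivity)]
    congr 2
    rw [Module.finrank_fin_fun, inv_pow, inv_inv, abs_of_pos (by positivity)]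
  have hpos : volume (B 1) ≠ 0 := by
    refine ((Bopen 1).measure_pos _ ⟨0, ?_⟩).ne'
    simp [hB, gzero]
  have hfin : volume (B 1) ≠ ⊤ := by
    have : Nonempty (Fin m) := ⟨⟨0, hm⟩⟩
    obtain ⟨z, hz, hmin⟩ := (isCompact_sphere (0 : Fin m → ℝ) 1).exists_isMinOn
      (NormedSpace.sphere_nonempty.mpr zero_le_one) gcont.continuousOn
    have hz0 : 0 < g z := by
      refine lt_of_le_of_ne (g0 z) fun hc => ?_
      have := gz z hc.symm
      simp [this] at hz
    have hsub : B 1 ⊆ Metric.closedBall 0 ((1 / g z) ^ (1 / p)) := by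
      intro y hy
      rw [mem_closedBall_zero_iff]
      rcases eq_or_ne y 0 with rfl | hy0
      · simp; positivity
      have hn : 0 < ‖y‖ := norm_pos_iff.mpr hy0
      have h1 : g z ≤ g (‖y‖⁻¹ • y) := by
        apply hmin
        simp [norm_smul, hn.ne']
      have h2 : g y = ‖y‖ ^ p * g (‖y‖⁻¹ • y) := by
        rw [gs, abs_of_pos (by positivity), Real.inv_rpow hn.le, mul_inv_cancel_left₀ (by positivity)]
      have hy1 : g y < 1 := hy
      have hnp : 0 < ‖y‖ ^ p := by positivity
      have h3 : ‖y‖ ^ p ≤ 1 / g z := by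
        rw [le_div_iff₀ hz0]
        nlinarith
      calc ‖y‖ = (‖y‖ ^ p) ^ (1 / p) := by
            rw [← Real.rpow_mul hn.le]; simp [hp0.ne']
        _ ≤ _ := Real.rpow_le_rpow hnp.le h3 (by positivity)
    exact (lt_of_le_of_lt (measure_mono hsub) Metric.isBounded_closedBall.measure_lt_top).ne
  have hdisj : Pairwise (Function.onFun Disjoint fun i => (fun y => y + -x i) ⁻¹' B t) := by
    intro i j hij
    rw [Function.onFun, Set.disjoint_left]
    intro y h1 h2
    have h1 : g (y + -x i) < t := h1
    have h2 : g (y + -x j) < t := h2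
    have h3 := ga (-(y + -x i)) (y + -x j)
    rw [gneg] at h3
    have e : -(y + -x i) + (y + -x j) = x i - x j := by abel
    rw [e] at h3
    have := hsep i j hij
    linarith
  have hU : (⋃ i, (fun y => y + -x i) ⁻¹' B t) ⊆ B (1 + t) := by
    intro y hy
    obtain ⟨i, hi⟩ := mem_iUnion.mp hy
    have hi : g (y + -x i) < t := hi
    have := ga (y + -x i) (x i)
    rw [neg_add_cancel_right] at this
    have := hball i
    change g y < 1 + t
    linarith
  have hvol := measure_mono (μ := volume) hU
  rw [measure_iUnion hdisj (fun i => ((Bopen t).measurableSet.preimage (measurable_add_const _)))] at hvol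
  simp only [measure_preimage_add_right] at hvol
  rw [tsum_fintype, Finset.sum_const, Finset.card_univ, Fintype.card_fin, nsmul_eq_mul,
    Bscale t ht, Bscale (1 + t) (by positivity), ← mul_assoc,
    ENNReal.mul_le_mul_iff_left hpos hfin, ← ENNReal.ofReal_natCast,
    ← ENNReal.ofReal_mul (by positivity)] at hvol
  exact (ENNReal.ofReal_le_ofReal_iff (by positivity)).mp hvol

/-- **Volume packing bound in an `m`-dimensional `p`-normed space.** If
`x_1, …, x_K` lie in the open unit ball and are `ε`-separated, then
`K ≤ (2^{1/p} (1 + ε^p/2)^{1/p} / ε)^m`. -/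
theorem packing_bound_pNorm {X : Type*} [AddCommGroup X] [Module ℝ X]
    [FiniteDimensional ℝ X] (p : ℝ) (hp0 : 0 < p) (hp1 : p ≤ 1)
    (m : ℕ) (hm : 1 ≤ m) (hdim : Module.finrank ℝ X = m)
    (NX : X → ℝ) (hNX : IsPNorm p NX) (ε : ℝ) (hε : 0 < ε)
    (K : ℕ) (x : Fin K → X) (hball : ∀ i, NX (x i) < 1)
    (hsep : ∀ i j, i ≠ j → ε ≤ NX (x i - x j)) :
    (K : ℝ) ≤ ((2 : ℝ) ^ (1 / p) * (1 + ε ^ p / 2) ^ (1 / p) / ε) ^ m := by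
  let e : X ≃ₗ[ℝ] (Fin m → ℝ) := (Module.finBasisOfFinrankEq ℝ X hdim).equivFun
  have key := packing_aux m hm p hp0 (fun y => NX (e.symm y) ^ p)
    (fun y => Real.rpow_nonneg (hNX.nonneg _) _)
    (fun y hy => by
      have h1 := (Real.rpow_eq_zero (hNX.nonneg _) hp0.ne').mp hy
      have h2 := (hNX.eq_zero_iff _).mp h1
      simpa using h2)
    (fun a y => by
      simp only [map_smul, hNX.smul_eq]
      rw [Real.mul_rpow (abs_nonneg _) (hNX.nonneg _)])
    (fun y z => by
      simp only [map_add]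
      exact hNX.padd _ _)
    (ε ^ p / 2) (by positivity) K (fun i => e (x i))
    (fun i => by
      simp only [LinearEquiv.symm_apply_apply]
      exact Real.rpow_lt_one (hNX.nonneg _) (hball i) hp0)
    (fun i j hij => by
      simp only [map_sub, LinearEquiv.symm_apply_apply]
      have := Real.rpow_le_rpow hε.le (hsep i j hij) hp0.le
      linarith)
  have e1 : (ε ^ p / 2) ^ (1 / p) = ε / 2 ^ (1 / p) := by
    rw [Real.div_rpow (by positivity) (by norm_num), ← Real.rpow_mul hε.le]
    simp [hp0.ne']
  have h2 : (0 : ℝ) < 2 ^ (1 / p) := by positivity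
  rw [e1, ← le_div_iff₀ (by positivity), ← div_pow] at key
  rw [div_div_eq_mul_div, mul_comm ((1 + ε ^ p / 2) ^ (1 / p))] at key
  exact key
end

section
/- Let 0 < p ≤ 1, let X be a real vector space equipped with a p-norm ‖·‖_X, let M ⊆ X be a linear subspace, let 0 < ε ≤ 1, and let 𝒩 ⊆ {x ∈ X : ‖x‖_X < 2^{1/p}} be such that for every x ∈ X with ‖x‖_X < 1 there exist x' ∈ 𝒩 and z ∈ M with ‖x − (x' + z)‖_X < ε. Then for every 0 < δ ≤ 1 and every x ∈ X with ‖x‖_X < δ there exist x' ∈ 𝒩 and z ∈ M such that ‖z‖_X < 4^{1/p} and ‖x − δ(x' + z)‖_X < δ·ε. -/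
/-- **Rescaled choice from a lifted net (Lemma 1 of the paper).** If `𝒩` is a set of
vectors of quasi-norm `< 2^{1/p}` such that every `x` with `‖x‖_X < 1` is within `ε`
of some `x' + z` with `x' ∈ 𝒩`, `z ∈ M`, then for every `0 < δ ≤ 1` and every `x`
with `‖x‖_X < δ` there are `x' ∈ 𝒩` and `z ∈ M` with `‖z‖_X < 4^{1/p}` and
`‖x - δ(x' + z)‖_X < δ ε`. -/
theorem rescaled_net_choice {X : Type*} [AddCommGroup X] [Module ℝ X]
    (p : ℝ) (hp0 : 0 < p) (hp1 : p ≤ 1)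
    (NX : X → ℝ) (hNX : IsPNorm p NX) (M : Submodule ℝ X)
    (ε : ℝ) (hε0 : 0 < ε) (hε1 : ε ≤ 1) (𝒩 : Set X)
    (h𝒩 : ∀ x' ∈ 𝒩, NX x' < (2 : ℝ) ^ (1 / p))
    (hnet : ∀ x : X, NX x < 1 → ∃ x' ∈ 𝒩, ∃ z ∈ M, NX (x - (x' + z)) < ε)
    (δ : ℝ) (hδ0 : 0 < δ) (hδ1 : δ ≤ 1) (x : X) (hx : NX x < δ) :
    ∃ x' ∈ 𝒩, ∃ z ∈ M, NX z < (4 : ℝ) ^ (1 / p) ∧ NX (x - δ • (x' + z)) < δ * ε := by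
  have neg : ∀ v, NX (-v) = NX v := fun v => by
    have := hNX.smul_eq (-1) v
    simpa using this
  have hy : NX (δ⁻¹ • x) < 1 := by
    rw [hNX.smul_eq, abs_of_pos (inv_pos.mpr hδ0), inv_mul_lt_iff₀ hδ0]
    simpa using hx
  obtain ⟨x', hx', z, hz, h⟩ := hnet _ hy
  refine ⟨x', hx', z, hz, ?_, ?_⟩
  · have e : z = (δ⁻¹ • x + -x') + -(δ⁻¹ • x - (x' + z)) := by abel
    have h1 := hNX.padd (δ⁻¹ • x + -x') (-(δ⁻¹ • x - (x' + z)))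
    have h2 := hNX.padd (δ⁻¹ • x) (-x')
    rw [← e, neg] at h1
    rw [neg] at h2
    have a1 : NX (δ⁻¹ • x) ^ p < 1 := Real.rpow_lt_one (hNX.nonneg _) hy hp0
    have a2 : NX (δ⁻¹ • x - (x' + z)) ^ p < 1 :=
      Real.rpow_lt_one (hNX.nonneg _) (lt_of_lt_of_le h hε1) hp0
    have a3 : NX x' ^ p < 2 := by
      have := Real.rpow_lt_rpow (hNX.nonneg _) (h𝒩 x' hx') hp0
      rwa [← Real.rpow_mul (by norm_num), one_div_mul_cancel hp0.ne', Real.rpow_one] at this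
    have a4 : NX z ^ p < 4 := by linarith
    have := Real.rpow_lt_rpow (Real.rpow_nonneg (hNX.nonneg _) _) a4 (one_div_pos.mpr hp0)
    rwa [← Real.rpow_mul (hNX.nonneg _), mul_one_div_cancel hp0.ne', Real.rpow_one] at this
  · have e : x - δ • (x' + z) = δ • (δ⁻¹ • x - (x' + z)) := by
      rw [smul_sub, smul_inv_smul₀ hδ0.ne']
    rw [e, hNX.smul_eq, abs_of_pos hδ0]
    exact mul_lt_mul_of_pos_left h hδ0
end

section
/- Let 0 < p ≤ q ≤ 2. Then there exists a constant c_{p,q} > 0, independent of n and N, such that for all N ∈ ℕ, all 1 ≤ n ≤ N, and every linear subspace M ⊆ ℝ^N with codim M < n, one has sup{‖x‖_q : x ∈ M, ‖x‖_p ≤ 1} ≥ c_{p,q} · min{1, (1 + log(N/n))/n}^{1/p − 1/q}. -/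
/-- The `ℓ_r` quasi-norm on `ℝ^N`: `‖x‖_r = (Σ_{i=1}^N |x i|^r)^{1/r}`. -/
noncomputable def lpNorm (r : ℝ) {N : ℕ} (x : Fin N → ℝ) : ℝ :=
  (∑ i, |x i| ^ r) ^ (1 / r)

/-- The `n`-th Gelfand number of the identity `id : ℓ_p^N → ℓ_q^N`: the infimum over
linear subspaces `M ⊆ ℝ^N` of codimension `< n` of `sup {‖x‖_q : x ∈ M, ‖x‖_p ≤ 1}`
(encoded as the infimum of all upper bounds valid for some such `M`). -/
noncomputable def gelfandLpLq (p q : ℝ) (N n : ℕ) : ℝ :=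
  sInf {v : ℝ | ∃ M : Submodule ℝ (Fin N → ℝ),
    Module.finrank ℝ ((Fin N → ℝ) ⧸ M) < n ∧
    ∀ x ∈ M, lpNorm p x ≤ 1 → lpNorm q x ≤ v}

section Helpers
open scoped Pointwise

/-- Weighted Hoelder inequality for finite sums. -/
lemma holder_weighted {ι : Type*} (S : Finset ι) (f g : ι → ℝ) (hf : ∀ i, 0 ≤ f i)
    (hg : ∀ i, 0 ≤ g i) (a b : ℝ) (ha : 0 < a) (hb : 0 ≤ b) (hab : a + b = 1)
    (hG : 0 < ∑ i ∈ S, g i) :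
    ∑ i ∈ S, f i ^ a * g i ^ b ≤ (∑ i ∈ S, f i) ^ a * (∑ i ∈ S, g i) ^ b := by
  set F := ∑ i ∈ S, f i with hFdef
  set G := ∑ i ∈ S, g i with hGdef
  have hF : 0 ≤ F := Finset.sum_nonneg (fun i _ => hf i)
  rcases hF.eq_or_lt with h0 | hFpos
  · have hz : ∀ i ∈ S, f i = 0 := (Finset.sum_eq_zero_iff_of_nonneg (fun i _ => hf i)).1 h0.symm
    rw [Finset.sum_eq_zero]
    · positivity
    · intro i hi
      rw [hz i hi, Real.zero_rpow ha.ne', zero_mul]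
  · have key : ∀ i ∈ S, f i ^ a * g i ^ b ≤ (F ^ a * G ^ b) * (a * (f i / F) + b * (g i / G)) := by
      intro i _
      have h := Real.geom_mean_le_arith_mean2_weighted ha.le hb
        (div_nonneg (hf i) hF) (div_nonneg (hg i) hG.le) hab
      rw [Real.div_rpow (hf i) hF, Real.div_rpow (hg i) hG.le] at h
      have hFa : 0 < F ^ a := Real.rpow_pos_of_pos hFpos a
      have hGb : 0 < G ^ b := Real.rpow_pos_of_pos hG b
      calc f i ^ a * g i ^ b = (F ^ a * G ^ b) * (f i ^ a / F ^ a * (g i ^ b / G ^ b)) := by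
            field_simp
        _ ≤ _ := by gcongr
    refine (Finset.sum_le_sum key).trans (le_of_eq ?_)
    rw [← Finset.mul_sum, Finset.sum_add_distrib, ← Finset.mul_sum, ← Finset.mul_sum,
      ← Finset.sum_div, ← Finset.sum_div, ← hFdef, ← hGdef, div_self hFpos.ne', div_self hG.ne']
    rw [mul_one, mul_one, hab, mul_one]

open MeasureTheory in
/-- Volumetric packing bound. -/
lemma volume_packing {m : ℕ} {ι : Type*} (T : Finset ι) (y : ι → Fin m → ℝ)
    (U : Set (Fin m → ℝ)) (hUo : IsOpen U) (hUn : U.Nonempty) (hUb : Bornology.IsBounded U)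
    (t : ℝ) (ht : 0 ≤ t)
    (hdisj : ∀ i ∈ T, ∀ j ∈ T, i ≠ j → Disjoint (y i +ᵥ U) (y j +ᵥ U))
    (hsub : ∀ i ∈ T, (y i +ᵥ U) ⊆ t • U) : (T.card : ℝ) ≤ t ^ m := by
  have hpos : 0 < volume U := hUo.measure_pos volume hUn
  have hfin : volume U ≠ ⊤ := hUb.measure_lt_top.ne
  have h1 : volume (⋃ i ∈ T, (y i +ᵥ U)) = ∑ i ∈ T, volume (y i +ᵥ U) := by
    apply measure_biUnion_finset
    · intro i hi j hj hij
      exact hdisj i hi j hj hij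
    · intro i _
      exact (hUo.vadd (y i)).measurableSet
  have h2 : volume (⋃ i ∈ T, (y i +ᵥ U)) ≤ volume (t • U) :=
    measure_mono (Set.iUnion₂_subset hsub)
  rw [h1, Measure.addHaar_smul] at h2
  simp only [measure_vadd, Finset.sum_const, nsmul_eq_mul, Module.finrank_fin_fun] at h2
  rw [ENNReal.mul_le_mul_iff_left hpos.ne' hfin] at h2
  rw [abs_of_nonneg (by positivity)] at h2
  have := ENNReal.toReal_mono ENNReal.ofReal_ne_top h2
  rwa [ENNReal.toReal_ofReal (by positivity), ENNReal.toReal_natCast] at this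

/-- Number of words agreeing with `f` in at least half of the positions. -/
lemma agree_count (s K : ℕ) (hK : 1 ≤ K) (f : Fin s → Fin K) :
    (((Finset.univ.filter fun g : Fin s → Fin K =>
      s < 2 * (Finset.univ.filter fun i => f i = g i).card).card : ℕ) : ℝ) * Real.sqrt K ^ s
      ≤ (2 * K) ^ s := by
  have hK' : (1 : ℝ) ≤ K := by exact_mod_cast hK
  have hsq : 1 ≤ Real.sqrt K := Real.one_le_sqrt.2 hK'
  have h1 : ∑ g : Fin s → Fin K, ∏ i, (if f i = g i then (K : ℝ) else 1)
      = ∏ i : Fin s, ∑ a : Fin K, (if f i = a then (K : ℝ) else 1) := by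
    rw [Finset.prod_univ_sum]
    simp
  have h2 : ∏ i : Fin s, ∑ a : Fin K, (if f i = a then (K : ℝ) else 1) ≤ (2 * K) ^ s := by
    calc _ ≤ ∏ i : Fin s, (2 * K : ℝ) := by
          apply Finset.prod_le_prod
          · intro i _
            apply Finset.sum_nonneg
            intro a _
            split_ifs <;> positivity
          · intro i _
            calc ∑ a : Fin K, (if f i = a then (K : ℝ) else 1)
                ≤ ∑ a : Fin K, ((if f i = a then (K : ℝ) else 0) + 1) := by
                  apply Finset.sum_le_sum
                  intro a _
                  split_ifs <;> simp
              _ = 2 * K := by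
                  rw [Finset.sum_add_distrib]
                  simp
                  ring
      _ = _ := by simp
  refine le_trans ?_ (h1.le.trans h2)
  rw [← nsmul_eq_mul, ← Finset.sum_const]
  refine le_trans (Finset.sum_le_sum ?_) (Finset.sum_le_sum_of_subset_of_nonneg
    (Finset.subset_univ _) ?_)
  · intro g hg
    rw [Finset.mem_filter] at hg
    rw [Finset.prod_ite]
    simp only [Finset.prod_const, one_pow, mul_one]
    calc Real.sqrt K ^ s ≤ Real.sqrt K ^ (2 * (Finset.univ.filter fun i => f i = g i).card) :=
          pow_le_pow_right₀ hsq hg.2.le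
      _ = _ := by rw [pow_mul, Real.sq_sqrt (by positivity)]
  · intro g _ _
    apply Finset.prod_nonneg
    intro i _
    split_ifs <;> positivity

/-- A code with large size and large Hamming distance. -/
lemma exists_code (s K : ℕ) (hK : 1 ≤ K) (hs : 1 ≤ s) :
    ∃ T : Finset (Fin s → Fin K),
      (∀ f ∈ T, ∀ g ∈ T, f ≠ g → 2 * (Finset.univ.filter fun i => f i = g i).card ≤ s) ∧
      Real.sqrt K ^ s ≤ 2 ^ s * (T.card : ℝ) := by
  classical
  let good : Finset (Fin s → Fin K) → Prop := fun T =>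
    ∀ f ∈ T, ∀ g ∈ T, f ≠ g → 2 * (Finset.univ.filter fun i => f i = g i).card ≤ s
  have hne : (Finset.univ.filter good).Nonempty := ⟨∅, by simp [good]⟩
  obtain ⟨T, hT, hmax⟩ := Finset.exists_max_image _ (fun T : Finset (Fin s → Fin K) => T.card) hne
  rw [Finset.mem_filter] at hT
  refine ⟨T, hT.2, ?_⟩
  have hcover : (Finset.univ : Finset (Fin s → Fin K)) ⊆ T.biUnion (fun f =>
      Finset.univ.filter fun g : Fin s → Fin K =>
      s < 2 * (Finset.univ.filter fun i => f i = g i).card) := by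
    intro g _
    by_contra hg
    simp only [Finset.mem_biUnion, Finset.mem_filter, Finset.mem_univ, true_and, not_exists,
      not_and, not_lt] at hg
    have hgT : g ∉ T := by
      intro h
      have := hg g h
      simp at this
      omega
    have hgood : good (insert g T) := by
      intro f1 h1 f2 h2 hne
      rw [Finset.mem_insert] at h1 h2
      rcases h1 with rfl | h1 <;> rcases h2 with rfl | h2
      · exact absurd rfl hne
      · have := hg f2 h2
        simpa only [eq_comm] using this
      · exact hg f1 h1
      · exact hT.2 f1 h1 f2 h2 hne
    have := hmax (insert g T) (by simp [hgood])
    rw [Finset.card_insert_of_notMem hgT] at this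
    omega
  have hcard := (Finset.card_le_card hcover).trans Finset.card_biUnion_le
  have hcard' : ((K : ℝ)) ^ s * Real.sqrt K ^ s ≤ T.card * (2 * K) ^ s := by
    have h : ((K : ℝ)) ^ s ≤ ∑ f ∈ T, (((Finset.univ.filter fun g : Fin s → Fin K =>
      s < 2 * (Finset.univ.filter fun i => f i = g i).card).card : ℕ) : ℝ) := by
      have := hcard
      simp only [Finset.card_univ, Fintype.card_pi, Fintype.card_fin, Finset.prod_const] at this
      exact_mod_cast this
    calc _ ≤ (∑ f ∈ T, (((Finset.univ.filter fun g : Fin s → Fin K =>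
        s < 2 * (Finset.univ.filter fun i => f i = g i).card).card : ℕ) : ℝ)) * Real.sqrt K ^ s := by
          gcongr
      _ ≤ ∑ f ∈ T, ((2 : ℝ) * K) ^ s := by
          rw [Finset.sum_mul]
          exact Finset.sum_le_sum (fun f _ => agree_count s K hK f)
      _ = _ := by simp
  have hKpos : (0 : ℝ) < K := by exact_mod_cast hK
  rw [mul_pow] at hcard'
  have : (0 : ℝ) < (K : ℝ) ^ s := by positivity
  nlinarith

lemma abs_add_rpow_le {r : ℝ} (hr0 : 0 < r) (hr1 : r ≤ 1) (a b : ℝ) :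
    |a + b| ^ r ≤ |a| ^ r + |b| ^ r :=
  (Real.rpow_le_rpow (abs_nonneg _) (abs_add_le a b) hr0.le).trans
    (Real.rpow_add_le_add_rpow (abs_nonneg a) (abs_nonneg b) hr0.le hr1)

/-- Under the null space property, sparse well separated vectors stay separated in the quotient. -/
lemma nsp_separated {r : ℝ} (hr0 : 0 < r) (hr1 : r ≤ 1) {N : ℕ} (S : Finset (Fin N))
    (d z : Fin N → ℝ) (hd : ∀ i ∉ S, d i = 0)
    (hnsp : d + z ≠ 0 → 2 * ∑ i ∈ S, |(d + z) i| ^ r < ∑ i, |(d + z) i| ^ r) :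
    ∑ i, |d i| ^ r ≤ ∑ i, |z i| ^ r := by
  classical
  by_cases h0 : d + z = 0
  · have : d = -z := eq_neg_of_add_eq_zero_left h0
    rw [this]
    simp
  · have h := hnsp h0
    have e1 := Finset.sum_add_sum_compl S (fun i => |(d + z) i| ^ r)
    have e2 := Finset.sum_add_sum_compl S (fun i => |z i| ^ r)
    have e3 := Finset.sum_add_sum_compl S (fun i => |d i| ^ r)
    have e4 : ∑ i ∈ Sᶜ, |d i| ^ r = 0 := by
      apply Finset.sum_eq_zero
      intro i hi
      rw [hd i (by simpa using hi), abs_zero, Real.zero_rpow hr0.ne']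
    have e5 : ∑ i ∈ Sᶜ, |(d + z) i| ^ r = ∑ i ∈ Sᶜ, |z i| ^ r := by
      apply Finset.sum_congr rfl
      intro i hi
      rw [Pi.add_apply, hd i (by simpa using hi), zero_add]
    have e6 : ∑ i ∈ S, |d i| ^ r ≤ ∑ i ∈ S, |(d + z) i| ^ r + ∑ i ∈ S, |z i| ^ r := by
      rw [← Finset.sum_add_distrib]
      apply Finset.sum_le_sum
      intro i _
      have := abs_add_rpow_le hr0 hr1 ((d + z) i) (-z i)
      simpa using this
    linarith

lemma nsp_packing {r : ℝ} (hr0 : 0 < r) (hr1 : r ≤ 1) {N s K : ℕ} (hs : 1 ≤ s) (hK : 1 ≤ K)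
    (hN : s * K ≤ N) (M : Submodule ℝ (Fin N → ℝ))
    (hnsp : ∀ v ∈ M, v ≠ 0 → ∀ S : Finset (Fin N), S.card ≤ 2 * s →
      2 * ∑ i ∈ S, |v i| ^ r < ∑ i, |v i| ^ r) :
    Real.sqrt K ^ s ≤ 2 ^ s * ((3 : ℝ) ^ (1 / r)) ^ Module.finrank ℝ ((Fin N → ℝ) ⧸ M) := by
  classical
  obtain ⟨T, hT, hcard⟩ := exists_code s K hK hs
  refine hcard.trans ?_
  gcongr
  set m := Module.finrank ℝ ((Fin N → ℝ) ⧸ M) with hm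
  let φ : ((Fin N → ℝ) ⧸ M) ≃ₗ[ℝ] (Fin m → ℝ) := LinearEquiv.ofFinrankEq _ _ (by simp [hm])
  let L : (Fin N → ℝ) →ₗ[ℝ] (Fin m → ℝ) := φ.toLinearMap ∘ₗ M.mkQ
  have hLsurj : Function.Surjective L := φ.surjective.comp M.mkQ_surjective
  have hLker : ∀ x, L x = 0 → x ∈ M := by
    intro x hx
    have : M.mkQ x = 0 := by
      apply φ.injective
      rw [map_zero]
      exact hx
    simpa using this
  -- the embedding
  let e : Fin s × Fin K → Fin N := fun a => Fin.castLE hN (finProdFinEquiv a)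
  have he : Function.Injective e :=
    (Fin.castLE_injective hN).comp finProdFinEquiv.injective
  let Sf : (Fin s → Fin K) → Finset (Fin N) := fun f => Finset.univ.image (fun i => e (i, f i))
  have hSfinj : ∀ f : Fin s → Fin K, Function.Injective (fun i => e (i, f i)) := by
    intro f i j hij
    have := he hij
    exact (Prod.mk.inj this).1
  have hSfcard : ∀ f, (Sf f).card = s := by
    intro f
    rw [Finset.card_image_of_injective _ (hSfinj f)]
    simp
  have hSfinter : ∀ f g, ((Sf f) ∩ (Sf g)).card ≤ (Finset.univ.filter fun i => f i = g i).card := by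
    intro f g
    refine le_trans (Finset.card_le_card ?_) (Finset.card_image_le (f := fun i => e (i, f i)))
    intro j hj
    simp only [Sf, Finset.mem_inter, Finset.mem_image, Finset.mem_univ, true_and] at hj
    obtain ⟨⟨i, hi⟩, ⟨i', hi'⟩⟩ := hj
    have h2 := Prod.mk.inj (he (hi.trans hi'.symm))
    obtain ⟨h3, h4⟩ := h2
    subst h3
    simp only [Finset.mem_image, Finset.mem_filter, Finset.mem_univ, true_and]
    exact ⟨i, h4, hi⟩
  let x : (Fin s → Fin K) → Fin N → ℝ := fun f j => if j ∈ Sf f then 1 else 0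
  have hxsum : ∀ f, ∑ j, |x f j| ^ r = s := by
    intro f
    have : ∀ j, |x f j| ^ r = if j ∈ Sf f then 1 else 0 := by
      intro j
      simp only [x]
      split_ifs
      · simp
      · simp [Real.zero_rpow hr0.ne']
    simp only [this]
    rw [Finset.sum_ite_mem, Finset.univ_inter, Finset.sum_const, hSfcard]
    simp
  have hxdiff : ∀ f ∈ T, ∀ g ∈ T, f ≠ g → (s : ℝ) ≤ ∑ j, |(x f - x g) j| ^ r := by
    intro f hf g hg hfg
    have h1 := hT f hf g hg hfg
    have h2 := hSfinter f g
    have h3 : ∀ j, |(x f - x g) j| ^ r =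
        (if j ∈ Sf f \ Sf g then 1 else 0) + (if j ∈ Sf g \ Sf f then 1 else 0) := by
      intro j
      simp only [x, Pi.sub_apply, Finset.mem_sdiff]
      by_cases a : j ∈ Sf f <;> by_cases b : j ∈ Sf g <;> simp [a, b, Real.zero_rpow hr0.ne']
    simp only [h3]
    rw [Finset.sum_add_distrib, Finset.sum_ite_mem, Finset.sum_ite_mem]
    simp only [Finset.univ_inter, Finset.sum_const, nsmul_eq_mul, mul_one]
    have h4 := Finset.card_sdiff_add_card_inter (Sf f) (Sf g)
    have h5 := Finset.card_sdiff_add_card_inter (Sf g) (Sf f)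
    rw [Finset.inter_comm] at h5
    rw [hSfcard] at h4 h5
    have : s ≤ (Sf f \ Sf g).card + (Sf g \ Sf f).card := by omega
    exact_mod_cast this
  have hspos : (0 : ℝ) < s := by exact_mod_cast hs
  -- the ball
  let B : Set (Fin N → ℝ) := {z | ∑ j, |z j| ^ r < s / 2}
  have hBopen : IsOpen B := by
    apply isOpen_lt _ continuous_const
    apply continuous_finsetSum
    intro j _
    exact ((continuous_apply j).abs).rpow_const (fun _ => Or.inr hr0.le)
  have hBbdd : Bornology.IsBounded B := by
    rw [isBounded_iff_forall_norm_le]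
    refine ⟨(s / 2 : ℝ) ^ (1 / r), fun z hz => ?_⟩
    rw [pi_norm_le_iff_of_nonneg (by positivity)]
    intro j
    have h1 : |z j| ^ r ≤ s / 2 :=
      (Finset.single_le_sum (f := fun j => |z j| ^ r) (fun i _ => by positivity)
        (Finset.mem_univ j)).trans (le_of_lt hz)
    rw [Real.norm_eq_abs]
    calc |z j| = (|z j| ^ r) ^ (1 / r) := by
          rw [← Real.rpow_mul (abs_nonneg _), mul_one_div_cancel hr0.ne', Real.rpow_one]
      _ ≤ _ := Real.rpow_le_rpow (by positivity) h1 (by positivity)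
  have hLcont : Continuous L := LinearMap.continuous_of_finiteDimensional L
  have hUopen : IsOpen (L '' B) := by
    have := LinearMap.isOpenMap_of_finiteDimensional L hLsurj
    exact this B hBopen
  have hUne : (L '' B).Nonempty := by
    refine ⟨L 0, 0, ?_, rfl⟩
    simp only [B, Set.mem_ofPred_eq, Pi.zero_apply, abs_zero, Real.zero_rpow hr0.ne']
    simp
    omega
  have hUbdd : Bornology.IsBounded (L '' B) := by
    have := hBbdd.isCompact_closure.image hLcont
    exact this.isBounded.subset (Set.image_mono subset_closure)
  refine volume_packing T (fun f => L (x f)) (L '' B) hUopen hUne hUbdd ((3 : ℝ) ^ (1 / r))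
    (by positivity) ?_ ?_
  · intro f hf g hg hfg
    rw [Set.disjoint_left]
    rintro w ⟨_, ⟨u, hu, rfl⟩, hw⟩ ⟨_, ⟨v, hv, rfl⟩, hw'⟩
    have hmem : (x f - x g) + (u - v) ∈ M := by
      apply hLker
      simp only [vadd_eq_add] at hw hw'
      rw [map_add, map_sub, map_sub]
      have := hw.trans hw'.symm
      rw [sub_add_sub_comm, this, sub_self]
    have hsep := nsp_separated hr0 hr1 (Sf f ∪ Sf g) (x f - x g) (u - v) (by
      intro i hi
      simp only [Finset.mem_union, not_or] at hi
      simp [x, hi.1, hi.2]) (fun hne => hnsp _ hmem hne _ (by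
        refine (Finset.card_union_le _ _).trans ?_
        rw [hSfcard, hSfcard]
        omega))
    have h1 := hxdiff f hf g hg hfg
    have h2 : ∑ i, |(u - v) i| ^ r ≤ ∑ i, |u i| ^ r + ∑ i, |v i| ^ r := by
      rw [← Finset.sum_add_distrib]
      apply Finset.sum_le_sum
      intro i _
      have := abs_add_rpow_le hr0 hr1 (u i) (-v i)
      rw [abs_neg] at this
      simpa [sub_eq_add_neg] using this
    have hu' : ∑ j, |u j| ^ r < s / 2 := hu
    have hv' : ∑ j, |v j| ^ r < s / 2 := hv
    linarith
  · rintro f hf w ⟨_, ⟨u, hu, rfl⟩, rfl⟩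
    have hu' : ∑ j, |u j| ^ r < s / 2 := hu
    have h3 : (0 : ℝ) < (3 : ℝ) ^ (1 / r) := by positivity
    rw [Set.mem_smul_set_iff_inv_smul_mem₀ h3.ne']
    refine ⟨((3 : ℝ) ^ (1 / r))⁻¹ • (x f + u), ?_, by simp⟩
    change ∑ j, |(((3 : ℝ) ^ (1 / r))⁻¹ • (x f + u)) j| ^ r < s / 2
    have h4 : ∀ j, |(((3 : ℝ) ^ (1 / r))⁻¹ • (x f + u)) j| ^ r ≤
        (1 / 3) * (|x f j| ^ r + |u j| ^ r) := by
      intro j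
      rw [Pi.smul_apply, smul_eq_mul, abs_mul, Real.mul_rpow (abs_nonneg _) (abs_nonneg _),
        abs_of_pos (inv_pos.2 h3), Real.inv_rpow h3.le, ← Real.rpow_mul (by norm_num),
        one_div_mul_cancel hr0.ne', Real.rpow_one, ← one_div]
      gcongr
      exact abs_add_rpow_le hr0 hr1 _ _
    refine lt_of_le_of_lt (Finset.sum_le_sum (fun j _ => h4 j)) ?_
    rw [← Finset.mul_sum, Finset.sum_add_distrib, hxsum]
    linarith

lemma holder_subset {r q : ℝ} (hr0 : 0 < r) (hrq : r ≤ q) {N : ℕ} (S : Finset (Fin N))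
    (v : Fin N → ℝ) :
    ∑ i ∈ S, |v i| ^ r ≤ (S.card : ℝ) ^ (1 - r / q) * (∑ i, |v i| ^ q) ^ (r / q) := by
  have hq0 : 0 < q := hr0.trans_le hrq
  have hrq1 : r / q ≤ 1 := (div_le_one hq0).2 hrq
  rcases S.eq_empty_or_nonempty with rfl | hS
  · simp
    positivity
  · have hc : (0 : ℝ) < S.card := by exact_mod_cast hS.card_pos
    have h := holder_weighted S (fun i => |v i| ^ q) (fun _ => 1) (fun i => by positivity)
      (fun _ => zero_le_one) (r / q) (1 - r / q) (by positivity) (by linarith) (by ring)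
      (by simpa using hc)
    have h2 : ∀ i, (|v i| ^ q) ^ (r / q) = |v i| ^ r := by
      intro i
      rw [← Real.rpow_mul (abs_nonneg _), mul_div_cancel₀ _ hq0.ne']
    simp only [h2, Real.one_rpow, mul_one, Finset.sum_const, nsmul_eq_mul] at h
    refine h.trans ?_
    rw [mul_comm]
    gcongr
    exact Finset.subset_univ S

/-- Choice of the sparsity parameter. -/
lemma choose_params {A : ℝ} (hA : 20 ≤ A) {N n : ℕ} (hn : 1 ≤ n)
    (hN : 4 * (A + 1) ^ 2 * n ≤ N) :
    ∃ s K : ℕ, 1 ≤ s ∧ 16 ≤ K ∧ s * K ≤ N ∧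
      (s : ℝ) * min 1 ((1 + Real.log ((N : ℝ) / n)) / n) ≤ A + 1 ∧
      A * n / 4 ≤ s * Real.log K := by
  have hn0 : (0 : ℝ) < n := by exact_mod_cast hn
  have hn1 : (1 : ℝ) ≤ n := by exact_mod_cast hn
  set t : ℝ := (N : ℝ) / n with ht
  have htN : (N : ℝ) = t * n := by rw [ht]; field_simp
  have ht1 : 4 * (A + 1) ^ 2 ≤ t := by
    rw [ht, le_div_iff₀ hn0]; exact hN
  have ht2 : (1764 : ℝ) ≤ t := by nlinarith
  have ht0 : 0 < t := by linarith
  have hlog1 : 1 ≤ Real.log t := by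
    rw [Real.le_log_iff_exp_le ht0]
    have := Real.exp_one_lt_d9
    linarith
  set L : ℝ := 1 + Real.log t with hL
  have hL0 : 0 < L := by linarith
  let s : ℕ := ⌈A * n / L⌉₊
  have hAn : 0 < A * n / L := by positivity
  have hs1 : 1 ≤ s := Nat.ceil_pos.2 hAn
  have hsl : A * n / L ≤ s := Nat.le_ceil _
  have hsu : (s : ℝ) < A * n / L + 1 := Nat.ceil_lt_add_one hAn.le
  have hs0 : (0 : ℝ) < s := by exact_mod_cast hs1
  have hsn : (s : ℝ) ≤ (A + 1) * n := by
    have : A * n / L ≤ A * n := div_le_self (by positivity) (by linarith)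
    nlinarith
  let K : ℕ := N / s
  have hsK : s * K ≤ N := Nat.mul_div_le N s
  have hKlow : t / (A + 1) < K + 1 := by
    have h1 : N < s * (K + 1) := by
      have := Nat.lt_mul_div_succ N (show 0 < s from hs1)
      exact this
    have h2 : (N : ℝ) < s * (K + 1) := by exact_mod_cast h1
    rw [div_lt_iff₀ (by linarith)]
    have h3 : t * n < ((K + 1) * (A + 1)) * n := by
      rw [← htN]
      calc (N : ℝ) < s * (K + 1) := h2
        _ ≤ ((A + 1) * n) * (K + 1) := by gcongr
        _ = _ := by ring
    exact lt_of_mul_lt_mul_right h3 hn0.le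
  have hsq : Real.sqrt t ^ 2 = t := Real.sq_sqrt ht0.le
  have hsqA : 2 * (A + 1) ≤ Real.sqrt t := by
    apply Real.le_sqrt_of_sq_le
    nlinarith
  have hKsqrt : Real.sqrt t ≤ K := by
    have h1 : 2 * Real.sqrt t ≤ t / (A + 1) := by
      rw [le_div_iff₀ (by linarith)]
      nlinarith
    nlinarith
  have hK16 : (16 : ℝ) ≤ K := by nlinarith
  refine ⟨s, K, hs1, by exact_mod_cast hK16, hsK, ?_, ?_⟩
  · have hm0 : 0 ≤ min 1 (L / n) := le_min zero_le_one (by positivity)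
    calc (s : ℝ) * min 1 (L / n) ≤ (A * n / L + 1) * min 1 (L / n) := by gcongr
      _ = A * n / L * min 1 (L / n) + 1 * min 1 (L / n) := by ring
      _ ≤ A * n / L * (L / n) + 1 * 1 := by
          gcongr
          · exact min_le_right _ _
          · exact min_le_left _ _
      _ = A + 1 := by field_simp
  · have hlogK : L / 4 ≤ Real.log K := by
      have h1 : Real.log (Real.sqrt t) ≤ Real.log K :=
        Real.log_le_log (Real.sqrt_pos.2 ht0) hKsqrt
      rw [Real.log_sqrt ht0.le] at h1
      linarith
    calc A * n / 4 = (A * n / L) * (L / 4) := by field_simp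
      _ ≤ s * Real.log K := by gcongr

lemma core {r q : ℝ} (hr0 : 0 < r) (hr1 : r ≤ 1) (hrq : r < q) :
    ∃ c : ℝ, 0 < c ∧ ∀ N n : ℕ, 1 ≤ n → n ≤ N →
      ∀ M : Submodule ℝ (Fin N → ℝ), Module.finrank ℝ ((Fin N → ℝ) ⧸ M) < n →
      ∀ E : ℝ, 0 ≤ E → (∀ v ∈ M, (∑ i, |v i| ^ q) ^ (r / q) ≤ E * ∑ i, |v i| ^ r) →
        c * min 1 ((1 + Real.log ((N : ℝ) / n)) / n) ^ (1 - r / q) ≤ E := by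
  have hq0 : 0 < q := hr0.trans hrq
  set β := 1 - r / q with hβ
  have hβ0 : 0 < β := by
    have := (div_lt_one hq0).2 hrq
    linarith
  set A : ℝ := 32 / r + 4 with hA
  have hA20 : 20 ≤ A := by
    have : 32 ≤ 32 / r := by
      rw [le_div_iff₀ hr0]
      nlinarith
    linarith
  set K0 : ℝ := 4 * (A + 1) ^ 2 with hK0
  have hK01 : 1 ≤ K0 := by nlinarith
  have hlogK0 : 0 ≤ Real.log K0 := Real.log_nonneg hK01
  have hc1 : 0 < (K0 * (1 + Real.log K0)) ^ (-β) := by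
    apply Real.rpow_pos_of_pos
    nlinarith
  have hc2 : 0 < 1 / 2 * (2 * (A + 1)) ^ (-β) := by
    have : 0 < (2 * (A + 1)) ^ (-β) := Real.rpow_pos_of_pos (by linarith) _
    linarith
  refine ⟨min ((K0 * (1 + Real.log K0)) ^ (-β)) (1 / 2 * (2 * (A + 1)) ^ (-β)),
    lt_min hc1 hc2, ?_⟩
  intro N n hn hnN M hM E hE hv
  have hn0 : (0 : ℝ) < n := by exact_mod_cast hn
  have hN0 : (0 : ℝ) < N := by exact_mod_cast (lt_of_lt_of_le hn hnN)
  have hlog : 0 ≤ Real.log ((N : ℝ) / n) := by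
    apply Real.log_nonneg
    rw [le_div_iff₀ hn0, one_mul]
    exact_mod_cast hnN
  set lam := (1 + Real.log ((N : ℝ) / n)) / n with hlam
  have hlam0 : 0 < lam := by positivity
  have hμ0 : 0 < min 1 lam := lt_min one_pos hlam0
  have hμβ : 0 < (min 1 lam) ^ β := Real.rpow_pos_of_pos hμ0 _
  have hpos : ∀ v : Fin N → ℝ, v ≠ 0 → 0 < ∑ i, |v i| ^ r := by
    intro v hv0
    obtain ⟨i, hi⟩ := Function.ne_iff.1 hv0
    apply Finset.sum_pos' (fun i _ => by positivity)
    refine ⟨i, Finset.mem_univ i, ?_⟩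
    have : 0 < |v i| := abs_pos.2 hi
    positivity
  by_cases hcase : K0 * n ≤ N
  · obtain ⟨s, K, hs, hK, hsK, hsμ, hsl⟩ := choose_params hA20 hn hcase
    by_contra hcon
    push Not at hcon
    have hs0 : (0 : ℝ) < s := by exact_mod_cast hs
    have hE2 : (2 * s : ℝ) ^ β * E < 1 / 2 := by
      have h1 : E < 1 / 2 * (2 * (A + 1)) ^ (-β) * (min 1 lam) ^ β :=
        hcon.trans_le (by gcongr; exact min_le_right _ _)
      have h2 : (2 * s : ℝ) ^ β * (min 1 lam) ^ β ≤ (2 * (A + 1)) ^ β := by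
        rw [← Real.mul_rpow (by positivity) hμ0.le]
        apply Real.rpow_le_rpow (by positivity) _ hβ0.le
        rw [mul_assoc]
        linarith
      have h3 : (0 : ℝ) < (2 * s : ℝ) ^ β := by positivity
      calc (2 * s : ℝ) ^ β * E < (2 * s : ℝ) ^ β * (1 / 2 * (2 * (A + 1)) ^ (-β) * (min 1 lam) ^ β) := by
            gcongr
        _ = 1 / 2 * (2 * (A + 1)) ^ (-β) * ((2 * s : ℝ) ^ β * (min 1 lam) ^ β) := by ring
        _ ≤ 1 / 2 * (2 * (A + 1)) ^ (-β) * (2 * (A + 1)) ^ β := by gcongr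
        _ = 1 / 2 := by
          rw [mul_assoc, ← Real.rpow_add (by linarith)]
          simp
    have hpack := nsp_packing hr0 hr1 hs (by omega : 1 ≤ K) hsK M (by
      intro v hvM hv0 S hS
      have h1 := holder_subset hr0 hrq.le S v
      have h2 : (S.card : ℝ) ^ β ≤ (2 * s : ℝ) ^ β := by
        apply Real.rpow_le_rpow (by positivity) _ hβ0.le
        exact_mod_cast hS
      have h3 := hv v hvM
      have h4 := hpos v hv0
      have h5 : ∑ i ∈ S, |v i| ^ r ≤ (2 * s : ℝ) ^ β * (E * ∑ i, |v i| ^ r) :=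
        h1.trans (mul_le_mul h2 h3 (by positivity) (by positivity))
      nlinarith)
    have hK0' : (0 : ℝ) < K := by
      have : 0 < K := by omega
      exact_mod_cast this
    have hlogs := Real.log_le_log (by positivity) hpack
    rw [Real.log_mul (by positivity) (by positivity), Real.log_pow, Real.log_pow, Real.log_pow,
      Real.log_sqrt hK0'.le, Real.log_rpow (by norm_num)] at hlogs
    have hlog16 : 4 * Real.log 2 ≤ Real.log K := by
      have : Real.log ((2 : ℝ) ^ 4) ≤ Real.log K := by
        apply Real.log_le_log (by norm_num)
        have : (16 : ℝ) ≤ K := by exact_mod_cast hK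
        linarith
      rw [Real.log_pow] at this
      exact_mod_cast this
    have hlog3 : Real.log 3 ≤ 2 := by
      have := Real.log_le_sub_one_of_pos (show (0 : ℝ) < 3 by norm_num)
      linarith
    have hlog3' : 0 ≤ Real.log 3 := Real.log_nonneg (by norm_num)
    have hmn : (Module.finrank ℝ ((Fin N → ℝ) ⧸ M) : ℝ) ≤ n := by exact_mod_cast hM.le
    have h6 : (Module.finrank ℝ ((Fin N → ℝ) ⧸ M) : ℝ) * (1 / r * Real.log 3) ≤ n * (1 / r * 2) := by
      gcongr
    have h7 : (s : ℝ) * (4 * Real.log 2) ≤ s * Real.log K := by gcongr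
    have h8 : A * n / 4 = 4 * (n * (1 / r * 2)) + n := by
      rw [hA]
      field_simp
      ring
    nlinarith
  · push Not at hcase
    have hNe : M ≠ ⊥ := by
      rintro rfl
      have h1 := Submodule.finrank_quotient_add_finrank (⊥ : Submodule ℝ (Fin N → ℝ))
      rw [finrank_bot, Module.finrank_fin_fun] at h1
      omega
    obtain ⟨v, hvM, hv0⟩ := Submodule.exists_mem_ne_zero_of_ne_bot hNe
    have h1 := holder_subset hr0 hrq.le Finset.univ v
    rw [Finset.card_univ, Fintype.card_fin] at h1
    have h4 := hpos v hv0
    have h5 : ∑ i, |v i| ^ r ≤ (N : ℝ) ^ β * (E * ∑ i, |v i| ^ r) :=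
      h1.trans (by gcongr; exact hv v hvM)
    have h6 : 1 ≤ (N : ℝ) ^ β * E := by
      rw [← mul_assoc] at h5
      exact le_of_mul_le_mul_right (by linarith) h4
    have h7 : (N : ℝ) * min 1 lam ≤ K0 * (1 + Real.log K0) := by
      have h8 : Real.log ((N : ℝ) / n) ≤ Real.log K0 := by
        apply Real.log_le_log (by positivity)
        rw [div_le_iff₀ hn0]
        exact hcase.le
      calc (N : ℝ) * min 1 lam ≤ (K0 * n) * ((1 + Real.log K0) / n) := by
            gcongr
            refine (min_le_right _ _).trans ?_
            rw [hlam]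
            gcongr
        _ = _ := by field_simp
    have h9 : (N : ℝ) ^ β * (min 1 lam) ^ β ≤ (K0 * (1 + Real.log K0)) ^ β := by
      rw [← Real.mul_rpow hN0.le hμ0.le]
      exact Real.rpow_le_rpow (by positivity) h7 hβ0.le
    have hNβ : 0 < (N : ℝ) ^ β := by positivity
    have h10 : (N : ℝ) ^ β * ((K0 * (1 + Real.log K0)) ^ (-β) * (min 1 lam) ^ β) ≤ 1 := by
      calc _ = (K0 * (1 + Real.log K0)) ^ (-β) * ((N : ℝ) ^ β * (min 1 lam) ^ β) := by ring
        _ ≤ (K0 * (1 + Real.log K0)) ^ (-β) * (K0 * (1 + Real.log K0)) ^ β := by gcongr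
        _ = 1 := by
          rw [← Real.rpow_add (by nlinarith)]
          simp
    calc _ ≤ (K0 * (1 + Real.log K0)) ^ (-β) * (min 1 lam) ^ β := by
          gcongr
          exact min_le_left _ _
      _ ≤ E := le_of_mul_le_mul_left (h10.trans h6) hNβ

end Helpers

/-- **Lower bound for the Gelfand widths of `ℓ_p^N` in `ℓ_q^N`, `0 < p ≤ q ≤ 2`.**
There is a constant `c > 0`, independent of `n` and `N`, such that for all
`1 ≤ n ≤ N` and every linear subspace `M ⊆ ℝ^N` of codimension `< n`,
`sup {‖x‖_q : x ∈ M, ‖x‖_p ≤ 1} ≥ c · min{1, (1+log(N/n))/n}^{1/p-1/q}`. -/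
theorem gelfand_lp_lq_lower_bound (p q : ℝ) (hp0 : 0 < p) (hpq : p ≤ q) (hq2 : q ≤ 2) :
    ∃ c : ℝ, 0 < c ∧ ∀ N n : ℕ, 1 ≤ n → n ≤ N →
      ∀ M : Submodule ℝ (Fin N → ℝ), Module.finrank ℝ ((Fin N → ℝ) ⧸ M) < n →
        c * min 1 ((1 + Real.log ((N : ℝ) / (n : ℝ))) / (n : ℝ)) ^ (1 / p - 1 / q)
          ≤ sSup ((fun x => lpNorm q x) '' {x : Fin N → ℝ | x ∈ M ∧ lpNorm p x ≤ 1}) := by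
  have hq0 : 0 < q := hp0.trans_le hpq
  have hbdd : ∀ (N : ℕ) (M : Submodule ℝ (Fin N → ℝ)),
      BddAbove ((fun x => lpNorm q x) '' {x : Fin N → ℝ | x ∈ M ∧ lpNorm p x ≤ 1}) := by
    intro N M
    refine ⟨1, ?_⟩
    rintro _ ⟨x, ⟨_, hx⟩, rfl⟩
    have hP0 : 0 ≤ ∑ i, |x i| ^ p := Finset.sum_nonneg (fun i _ => by positivity)
    have hP : ∑ i, |x i| ^ p ≤ 1 := by
      by_contra h
      push Not at h
      have := Real.one_lt_rpow h (show 0 < 1 / p by positivity)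
      unfold lpNorm at hx
      linarith
    have hi : ∀ i, |x i| ^ q ≤ |x i| ^ p := by
      intro i
      have h1 : |x i| ^ p ≤ 1 := (Finset.single_le_sum (f := fun j => |x j| ^ p)
        (fun i _ => by positivity) (Finset.mem_univ i)).trans hP
      have h2 : |x i| ≤ 1 := by
        by_contra h
        push Not at h
        have := Real.one_lt_rpow h hp0
        linarith
      rcases (abs_nonneg (x i)).eq_or_lt with h0 | h0
      · rw [← h0, Real.zero_rpow hp0.ne', Real.zero_rpow hq0.ne']
      · exact Real.rpow_le_rpow_of_exponent_ge h0 h2 hpq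
    have : ∑ i, |x i| ^ q ≤ 1 := (Finset.sum_le_sum (fun i _ => hi i)).trans hP
    exact Real.rpow_le_one (Finset.sum_nonneg (fun i _ => by positivity)) this (by positivity)
  have hD : ∀ (N : ℕ) (M : Submodule ℝ (Fin N → ℝ)), ∀ x ∈ M, x ≠ 0 → lpNorm q x ≤
      sSup ((fun x => lpNorm q x) '' {x : Fin N → ℝ | x ∈ M ∧ lpNorm p x ≤ 1}) * lpNorm p x := by
    intro N M x hx hx0
    have hhom : ∀ (r : ℝ), 0 < r → ∀ a : ℝ, 0 ≤ a → lpNorm r (a • x) = a * lpNorm r x := by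
      intro r hr a ha
      unfold lpNorm
      simp only [Pi.smul_apply, smul_eq_mul, abs_mul, abs_of_nonneg ha,
        Real.mul_rpow ha (abs_nonneg _)]
      rw [← Finset.mul_sum, Real.mul_rpow (by positivity)
        (Finset.sum_nonneg (fun i _ => by positivity)), ← Real.rpow_mul ha,
        mul_one_div_cancel hr.ne', Real.rpow_one]
    have hPpos : 0 < ∑ i, |x i| ^ p := by
      obtain ⟨i, hi⟩ := Function.ne_iff.1 hx0
      apply Finset.sum_pos' (fun i _ => by positivity)
      refine ⟨i, Finset.mem_univ i, ?_⟩
      have : 0 < |x i| := abs_pos.2 hi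
      positivity
    have hp' : 0 < lpNorm p x := Real.rpow_pos_of_pos hPpos _
    have h := le_csSup (hbdd N M) (Set.mem_image_of_mem (fun x => lpNorm q x)
      (show (lpNorm p x)⁻¹ • x ∈ {x : Fin N → ℝ | x ∈ M ∧ lpNorm p x ≤ 1} from
        ⟨M.smul_mem _ hx, by rw [hhom p hp0 _ (by positivity), inv_mul_cancel₀ hp'.ne']⟩))
    rw [hhom q hq0 _ (by positivity), inv_mul_le_iff₀ hp', mul_comm] at h
    exact h
  have hposs : ∀ (r : ℝ) (N : ℕ) (v : Fin N → ℝ), v ≠ 0 → 0 < ∑ i, |v i| ^ r := by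
    intro r N v hv0
    obtain ⟨i, hi⟩ := Function.ne_iff.1 hv0
    apply Finset.sum_pos' (fun i _ => by positivity)
    refine ⟨i, Finset.mem_univ i, ?_⟩
    have : 0 < |v i| := abs_pos.2 hi
    positivity
  rcases hpq.eq_or_lt with rfl | hlt
  · refine ⟨1, one_pos, ?_⟩
    intro N n hn hnN M hM
    have hNe : M ≠ ⊥ := by
      rintro rfl
      have h1 := Submodule.finrank_quotient_add_finrank (⊥ : Submodule ℝ (Fin N → ℝ))
      rw [finrank_bot, Module.finrank_fin_fun] at h1
      omega
    obtain ⟨v, hvM, hv0⟩ := Submodule.exists_mem_ne_zero_of_ne_bot hNe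
    have h := hD N M v hvM hv0
    have h2 : 0 < lpNorm p v := Real.rpow_pos_of_pos (hposs p N v hv0) _
    rw [sub_self, Real.rpow_zero, mul_one]
    exact le_of_mul_le_mul_right (by linarith) h2
  · set r := min p 1 with hr
    have hr0 : 0 < r := lt_min hp0 one_pos
    have hrp : r ≤ p := min_le_left _ _
    have hrq : r < q := hrp.trans_lt hlt
    obtain ⟨c, hc0, hc⟩ := core hr0 (min_le_right _ _) hrq
    set a := (q - p) / (q - r) with ha
    have hqr : 0 < q - r := by linarith
    have ha0 : 0 < a := div_pos (by linarith) hqr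
    have ha1 : a ≤ 1 := (div_le_one hqr).2 (by linarith)
    have haeq : r * a + q * (1 - a) = p := by
      rw [ha]
      field_simp
      ring
    refine ⟨c ^ (a / p), by positivity, ?_⟩
    intro N n hn hnN M hM
    set D := sSup ((fun x => lpNorm q x) '' {x : Fin N → ℝ | x ∈ M ∧ lpNorm p x ≤ 1}) with hDdef
    have hDnn : 0 ≤ D := by
      apply Real.sSup_nonneg
      rintro _ ⟨x, _, rfl⟩
      exact Real.rpow_nonneg (Finset.sum_nonneg (fun i _ => by positivity)) _
    have hmain := hc N n hn hnN M hM (D ^ (p / a)) (by positivity) (by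
      intro v hvM
      by_cases hv0 : v = 0
      · subst hv0
        simp [Real.zero_rpow hq0.ne', Real.zero_rpow hr0.ne',
          Real.zero_rpow (div_pos hr0 hq0).ne']
      have hP := hposs p N v hv0
      have hQ := hposs q N v hv0
      have hR := hposs r N v hv0
      have h1 := hD N M v hvM hv0
      have h2 := holder_weighted Finset.univ (fun i => |v i| ^ r) (fun i => |v i| ^ q)
        (fun i => by positivity) (fun i => by positivity) a (1 - a) ha0 (by linarith) (by ring) hQ
      have h3 : ∀ i, (|v i| ^ r) ^ a * (|v i| ^ q) ^ (1 - a) = |v i| ^ p := by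
        intro i
        rw [← Real.rpow_mul (abs_nonneg _), ← Real.rpow_mul (abs_nonneg _)]
        rcases (abs_nonneg (v i)).eq_or_lt with h0 | h0
        · rw [← h0, Real.zero_rpow hp0.ne', Real.zero_rpow (mul_pos hr0 ha0).ne', zero_mul]
        · rw [← Real.rpow_add h0, haeq]
      simp only [h3] at h2
      rw [← hDdef] at h1
      unfold lpNorm at h1
      set P := ∑ i, |v i| ^ p
      set Q := ∑ i, |v i| ^ q
      set R := ∑ i, |v i| ^ r
      -- raise to the power `p / a`
      have h4 : (Q ^ (1 / q)) ^ (p / a) ≤ (D * P ^ (1 / p)) ^ (p / a) :=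
        Real.rpow_le_rpow (by positivity) h1 (by positivity)
      rw [Real.mul_rpow hDnn (by positivity), ← Real.rpow_mul hQ.le, ← Real.rpow_mul hP.le] at h4
      have h5 : P ^ (1 / p * (p / a)) ≤ R * Q ^ ((1 - a) / a) := by
        have h6 : P ^ (1 / a) ≤ (R ^ a * Q ^ (1 - a)) ^ (1 / a) :=
          Real.rpow_le_rpow hP.le h2 (by positivity)
        rw [Real.mul_rpow (by positivity) (by positivity), ← Real.rpow_mul hR.le,
          ← Real.rpow_mul hQ.le, mul_one_div_cancel ha0.ne', Real.rpow_one, mul_one_div] at h6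
        have : 1 / p * (p / a) = 1 / a := by field_simp
        rw [this]
        exact h6
      have h7 : Q ^ (1 / q * (p / a)) = Q ^ (r / q) * Q ^ ((1 - a) / a) := by
        rw [← Real.rpow_add hQ]
        congr 1
        field_simp
        linarith
      have h8 : Q ^ (r / q) * Q ^ ((1 - a) / a) ≤ (D ^ (p / a) * R) * Q ^ ((1 - a) / a) := by
        rw [← h7, mul_assoc]
        refine h4.trans ?_
        gcongr
      exact le_of_mul_le_mul_right h8 (by positivity))
    have hn0 : (0 : ℝ) < n := by exact_mod_cast hn
    have hlog : 0 ≤ Real.log ((N : ℝ) / n) := by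
      apply Real.log_nonneg
      rw [le_div_iff₀ hn0, one_mul]
      exact_mod_cast hnN
    set μ := min 1 ((1 + Real.log ((N : ℝ) / (n : ℝ))) / (n : ℝ)) with hμ
    have hμ0 : 0 < μ := lt_min one_pos (by positivity)
    have h1 := Real.rpow_le_rpow (by positivity) hmain (show 0 ≤ a / p by positivity)
    rw [Real.mul_rpow hc0.le (by positivity), ← Real.rpow_mul hμ0.le, ← Real.rpow_mul hDnn] at h1
    have e1 : p / a * (a / p) = 1 := by field_simp
    have e2 : (1 - r / q) * (a / p) = 1 / p - 1 / q := by
      rw [ha]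
      field_simp
    rw [e1, e2, Real.rpow_one] at h1
    exact h1
end
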